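/- arXiv:math/0701346 — 2 statements merged into one kernel-verified Lean document; each statement's English description precedes it below -/
import Mathlib

section
/- Let W be a graphon and let (G_n) be a sequence of weighted graphs with |G_n| = n, β_max = sup_{i,j,n} β_ij(n) < ∞ and G_n → W. Then there exists a function ω₀(n) → ∞ such that for every function ω(n) → ∞ with ω(n) ≤ ω₀(n) for all n, the number N_{>ω}(G_n(1/n)) of vertices of G_n(1/n) in components with more than ω(n) vertices satisfies (1/n)·N_{>ω}(G_n(1/n)) → ρ(W) in probability as n → ∞. -/
open MeasureTheory Filter Topology

noncomputable section

namespace Percolation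

/-- The symmetrized lift of a two-variable real function to `Sym2`. If `f` is symmetric,
`sym2Val f s(a, b) = f a b`. -/
def sym2Val {α : Type*} (f : α → α → ℝ) : Sym2 α → ℝ :=
  Sym2.lift ⟨fun a b => (f a b + f b a) / 2, fun a b => by simp [add_comm]⟩

/-- The product over the edges of `F` of a symmetric function of the endpoints. -/
def edgeProd {k : ℕ} (F : SimpleGraph (Fin k)) (f : Fin k → Fin k → ℝ) : ℝ := by
  classical exact ∏ e ∈ F.edgeFinset, sym2Val f e

/-- The homomorphism density `t(F, G)` of a finite simple graph `F` in the weighted graph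
on `[n]` with edge weights `β`. -/
def homDensityG {n k : ℕ} (β : Fin n → Fin n → ℝ) (F : SimpleGraph (Fin k)) : ℝ :=
  (∑ v : Fin k → Fin n, edgeProd F fun i j => β (v i) (v j)) / (n : ℝ) ^ k

/-- The unit interval `[0,1] ⊆ ℝ`. -/
def I01 : Set ℝ := Set.Icc 0 1

/-- The homomorphism density `t(F, W)` of a finite simple graph `F` in a graphon `W`. -/
def homDensityW {k : ℕ} (W : ℝ → ℝ → ℝ) (F : SimpleGraph (Fin k)) : ℝ :=
  ∫ x : Fin k → ℝ in Set.univ.pi fun _ => I01, edgeProd F fun i j => W (x i) (x j)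

/-- `G_n → W`: convergence of the homomorphism densities for every finite simple graph. -/
def ConvergesTo (β : ∀ n : ℕ, Fin n → Fin n → ℝ) (W : ℝ → ℝ → ℝ) : Prop :=
  ∀ (k : ℕ) (F : SimpleGraph (Fin k)),
    Tendsto (fun n => homDensityG (β n) F) atTop (nhds (homDensityW W F))

/-- `W` is a graphon: a bounded symmetric measurable function with nonnegative values. -/
def IsGraphon (W : ℝ → ℝ → ℝ) : Prop :=
  Measurable (Function.uncurry W) ∧ (∀ x y, 0 ≤ W x y) ∧ (∀ x y, W x y = W y x) ∧
    ∃ M : ℝ, ∀ x y, W x y ≤ M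

/-- The Bernoulli measure on `Bool` with success probability `p`. -/
def bern (p : ℝ) : Measure Bool :=
  ENNReal.ofReal p • Measure.dirac true + ENNReal.ofReal (1 - p) • Measure.dirac false

/-- The law of the random graph in which each pair `{v, w}` is an edge independently
with probability `min (p * β v w) 1`; a point of the sample space records for each
unordered pair whether it is an edge. -/
def percMeasure {V : Type*} [Fintype V] [DecidableEq V] (β : V → V → ℝ) (p : ℝ) :
    Measure (Sym2 V → Bool) :=
  Measure.pi fun e => bern (min (p * sym2Val β e) 1)

/-- The simple graph determined by a point of the sample space. -/
def graphOf {V : Type*} (ω : Sym2 V → Bool) : SimpleGraph V :=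
  SimpleGraph.fromRel fun i j => ω s(i, j)

/-- The number of vertices of the component of `v` in `G`. -/
def compSize {V : Type*} (G : SimpleGraph V) (v : V) : ℕ := {w | G.Reachable v w}.ncard

/-- The number of vertices of the largest component of `G`. -/
def C1 {V : Type*} [Fintype V] (G : SimpleGraph V) : ℕ :=
  Finset.univ.sup fun v => compSize G v

/-- The number of vertices of the second largest component of `G` (zero if `G` is
connected): the largest value of `min (|C_v|, |C_w|)` over vertices `v`, `w` lying in
distinct components. -/
def C2 {V : Type*} (G : SimpleGraph V) : ℕ :=
  sSup {m | ∃ v w : V, ¬G.Reachable v w ∧ m = min (compSize G v) (compSize G w)}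

/-- The operator `T_W` with kernel `W` applied to `f`. -/
def applyT (W : ℝ → ℝ → ℝ) (f : ℝ → ℝ) (x : ℝ) : ℝ := ∫ y in I01, W x y * f y

/-- The `L²[0,1]` norm of a function. -/
def l2norm (f : ℝ → ℝ) : ℝ := Real.sqrt (∫ x in I01, f x ^ 2)

/-- The `L²`-operator norm `‖T_W‖` of the integral operator with kernel `W`. -/
def opNorm (W : ℝ → ℝ → ℝ) : ℝ :=
  sSup {r | ∃ f : ℝ → ℝ, Measurable f ∧
    MeasureTheory.IntegrableOn (fun x => f x ^ 2) I01 ∧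
    l2norm f ≤ 1 ∧ r = l2norm (applyT W f)}

/-- The survival probability `ρ(W)` of the multitype Poisson branching process with
kernel `W`: the supremum of `∫ f` over measurable `f : [0,1] → [0,1]` satisfying the
functional equation `f(x) = 1 - exp(-∫ W(x,y) f(y) dy)` almost everywhere. -/
def survival (W : ℝ → ℝ → ℝ) : ℝ :=
  sSup {r | ∃ f : ℝ → ℝ, Measurable f ∧ (∀ x, f x ∈ Set.Icc (0 : ℝ) 1) ∧
    (∀ᵐ x ∂volume.restrict I01, f x = 1 - Real.exp (-∫ y in I01, W x y * f y)) ∧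
    r = ∫ x in I01, f x}

/-- A graphon `W` is irreducible if there is no measurable `A ⊆ [0,1]` with
`0 < μ(A) < 1` such that `W = 0` a.e. on `A × ([0,1] \ A)`. -/
def Irreducible (W : ℝ → ℝ → ℝ) : Prop :=
  ¬∃ A : Set ℝ, MeasurableSet A ∧ A ⊆ I01 ∧ 0 < volume A ∧ volume A < 1 ∧
    ∀ᵐ p : ℝ × ℝ, p.1 ∈ A → p.2 ∈ I01 \ A → W p.1 p.2 = 0

end Percolation
namespace Percolation

/-- The number of vertices of `G` lying in components with more than `m` vertices. -/
def NkGT {V : Type*} (G : SimpleGraph V) (m : ℕ) : ℕ := {v | m < compSize G v}.ncard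

end Percolation

set_option linter.unusedSectionVars false

namespace Percolation

/-- iterated survival functions -/
def gIt {Ω : Type*} [MeasurableSpace Ω] (μ : Measure Ω) (K : Ω → Ω → ℝ) : ℕ → Ω → ℝ
  | 0 => fun _ => 1
  | r + 1 => fun x => 1 - Real.exp (-∫ y, K x y * gIt μ K r y ∂μ)

section gen
variable {Ω : Type*} [MeasurableSpace Ω] (μ : Measure Ω) (K : Ω → Ω → ℝ)

lemma gIt_mem (hK : ∀ x y, 0 ≤ K x y) (r : ℕ) (x : Ω) : gIt μ K r x ∈ Set.Icc (0:ℝ) 1 := by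
  induction r generalizing x with
  | zero => simp [gIt]
  | succ r ih =>
    have h : 0 ≤ ∫ y, K x y * gIt μ K r y ∂μ :=
      integral_nonneg fun y => mul_nonneg (hK x y) (ih y).1
    simp only [gIt, Set.mem_Icc]
    have h1 : Real.exp (-∫ y, K x y * gIt μ K r y ∂μ) ≤ 1 := Real.exp_le_one_iff.2 (by linarith)
    have h2 := Real.exp_pos (-∫ y, K x y * gIt μ K r y ∂μ)
    constructor <;> linarith

lemma measurable_T [SFinite μ] (hKm : Measurable (Function.uncurry K)) {f : Ω → ℝ}
    (hf : Measurable f) : Measurable fun x => ∫ y, K x y * f y ∂μ := by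
  have : StronglyMeasurable (Function.uncurry fun x y => K x y * f y) := by
    apply Measurable.stronglyMeasurable
    exact hKm.mul (hf.comp measurable_snd)
  exact this.integral_prod_right.measurable

lemma gIt_meas [SFinite μ] (hKm : Measurable (Function.uncurry K)) (r : ℕ) :
    Measurable (gIt μ K r) := by
  induction r with
  | zero => exact measurable_const
  | succ r ih =>
    have := measurable_T μ K hKm ih
    simp only [gIt]
    fun_prop

lemma integrable_of_bdd [IsFiniteMeasure μ] {f : Ω → ℝ} (hf : Measurable f) (C : ℝ)
    (h : ∀ x, |f x| ≤ C) : Integrable f μ :=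
  Integrable.of_bound hf.aestronglyMeasurable C (Eventually.of_forall h)

lemma integrable_Kf [IsFiniteMeasure μ] (hKm : Measurable (Function.uncurry K)) (M : ℝ)
    (hK : ∀ x y, 0 ≤ K x y) (hM : ∀ x y, K x y ≤ M) {f : Ω → ℝ}
    (hf : Measurable f) (hf1 : ∀ x, f x ∈ Set.Icc (0:ℝ) 1) (x : Ω) :
    Integrable (fun y => K x y * f y) μ := by
  refine integrable_of_bdd μ ((hKm.comp measurable_prodMk_left).mul hf) M fun y => ?_
  have h1 := hf1 y
  rw [abs_of_nonneg (mul_nonneg (hK x y) h1.1)]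
  nlinarith [hK x y, hM x y, h1.1, h1.2]

end gen

instance : IsFiniteMeasure (volume.restrict I01) := by
  unfold I01; infer_instance

lemma I01_real : (volume.restrict I01).real Set.univ = 1 := by
  simp [I01]

/-- the numbers `a_r` -/
def aSeq (W : ℝ → ℝ → ℝ) (r : ℕ) : ℝ := ∫ x in I01, gIt (volume.restrict I01) W r x

lemma survival_spec (W : ℝ → ℝ → ℝ) (hW : IsGraphon W) :
    (∀ r, survival W ≤ aSeq W r) ∧ Tendsto (aSeq W) atTop (nhds (survival W)) := by
  obtain ⟨hWm, hW0, hWs, M, hM⟩ := hW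
  set μ := volume.restrict I01 with hμ
  set g := gIt μ W with hg
  have hgm : ∀ r, Measurable (g r) := gIt_meas μ W hWm
  have hg01 : ∀ r x, g r x ∈ Set.Icc (0:ℝ) 1 := gIt_mem μ W hW0
  have hint : ∀ f : ℝ → ℝ, Measurable f → (∀ x, f x ∈ Set.Icc (0:ℝ) 1) → ∀ x,
      Integrable (fun y => W x y * f y) μ := fun f hf h1 x => integrable_Kf μ W hWm M hW0 hM hf h1 x
  have hint1 : ∀ f : ℝ → ℝ, Measurable f → (∀ x, f x ∈ Set.Icc (0:ℝ) 1) →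
      Integrable f μ := fun f hf h1 => integrable_of_bdd μ hf 1 fun x => by
        rw [abs_of_nonneg (h1 x).1]; exact (h1 x).2
  have hmono : ∀ r x, g (r+1) x ≤ g r x := by
    intro r
    induction r with
    | zero => intro x; exact (hg01 1 x).2
    | succ r ih =>
      intro x
      have : ∫ y, W x y * g (r+1) y ∂μ ≤ ∫ y, W x y * g r y ∂μ :=
        integral_mono (hint _ (hgm _) (hg01 _) x) (hint _ (hgm _) (hg01 _) x)
          fun y => mul_le_mul_of_nonneg_left (ih y) (hW0 x y)
      have h2 := Real.exp_le_exp.2 (neg_le_neg this)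
      show 1 - Real.exp (-∫ y, W x y * g (r+1) y ∂μ) ≤ 1 - Real.exp (-∫ y, W x y * g r y ∂μ)
      linarith
  have hanti : ∀ x, Antitone fun r => g r x := fun x => antitone_nat_of_succ_le fun r => hmono r x
  set f : ℝ → ℝ := fun x => ⨅ r, g r x with hf
  have hlim : ∀ x, Tendsto (fun r => g r x) atTop (nhds (f x)) := fun x =>
    tendsto_atTop_ciInf (hanti x) ⟨0, by rintro _ ⟨r, rfl⟩; exact (hg01 r x).1⟩
  have hfm : Measurable f := measurable_of_tendsto_metrizable hgm (tendsto_pi_nhds.2 hlim)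
  have hf01 : ∀ x, f x ∈ Set.Icc (0:ℝ) 1 := fun x =>
    isClosed_Icc.mem_of_tendsto (hlim x) (Eventually.of_forall fun r => hg01 r x)
  have hfix : ∀ x, f x = 1 - Real.exp (-∫ y, W x y * f y ∂μ) := by
    intro x
    have h1 : Tendsto (fun r => ∫ y, W x y * g r y ∂μ) atTop (nhds (∫ y, W x y * f y ∂μ)) := by
      refine tendsto_integral_of_dominated_convergence (fun _ => M)
        (fun r => (hint _ (hgm r) (hg01 r) x).aestronglyMeasurable) (integrable_const M) ?_ ?_
      · intro r
        refine Eventually.of_forall fun y => ?_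
        rw [Real.norm_eq_abs, abs_of_nonneg (mul_nonneg (hW0 x y) (hg01 r y).1)]
        nlinarith [hW0 x y, hM x y, (hg01 r y).1, (hg01 r y).2]
      · exact Eventually.of_forall fun y => (hlim y).const_mul _
    have h2 : Tendsto (fun r => g (r+1) x) atTop (nhds (1 - Real.exp (-∫ y, W x y * f y ∂μ))) :=
      ((Real.continuous_exp.tendsto _).comp h1.neg).const_sub 1
    exact tendsto_nhds_unique ((hlim x).comp (tendsto_add_atTop_nat 1)) h2
  have hA : Tendsto (aSeq W) atTop (nhds (∫ x, f x ∂μ)) := by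
    refine tendsto_integral_of_dominated_convergence (fun _ => 1)
        (fun r => (hgm r).aestronglyMeasurable) (integrable_const 1) ?_ ?_
    · intro r
      refine Eventually.of_forall fun y => ?_
      rw [Real.norm_eq_abs, abs_of_nonneg (hg01 r y).1]
      exact (hg01 r y).2
    · exact Eventually.of_forall fun y => hlim y
  have hub : ∀ h : ℝ → ℝ, Measurable h → (∀ x, h x ∈ Set.Icc (0 : ℝ) 1) →
    (∀ᵐ x ∂μ, h x = 1 - Real.exp (-∫ y, W x y * h y ∂μ)) → ∀ r, ∀ᵐ x ∂μ, h x ≤ g r x := by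
    intro h hm h01 hfixh r
    induction r with
    | zero => exact Eventually.of_forall fun x => (h01 x).2
    | succ r ih =>
      filter_upwards [hfixh] with x hx
      have : ∫ y, W x y * h y ∂μ ≤ ∫ y, W x y * g r y ∂μ := by
        apply integral_mono_ae (hint _ hm h01 x) (hint _ (hgm _) (hg01 _) x)
        filter_upwards [ih] with y hy
        exact mul_le_mul_of_nonneg_left hy (hW0 x y)
      have h2 := Real.exp_le_exp.2 (neg_le_neg this)
      rw [hx]
      show _ ≤ 1 - Real.exp (-∫ y, W x y * g r y ∂μ)
      linarith
  have hsurv : survival W = ∫ x, f x ∂μ := by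
    apply IsLUB.csSup_eq
    · constructor
      · rintro _ ⟨h, hm, h01, hfixh, rfl⟩
        refine ge_of_tendsto' hA fun r => ?_
        exact integral_mono_ae (hint1 h hm h01) (hint1 _ (hgm r) (hg01 r)) (hub h hm h01 hfixh r)
      · intro b hb
        exact hb ⟨f, hfm, hf01, Eventually.of_forall hfix, rfl⟩
    · exact ⟨_, f, hfm, hf01, Eventually.of_forall hfix, rfl⟩
  rw [hsurv]
  refine ⟨fun r => ?_, hA⟩
  refine integral_mono (hint1 _ hfm hf01) (hint1 _ (hgm r) (hg01 r)) fun x => ?_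
  exact ciInf_le ⟨0, by rintro _ ⟨r, rfl⟩; exact (hg01 r x).1⟩ r

end Percolation

namespace Percolation

/-- extension of a function by a root value -/
def ext {V Ω : Type*} (y : Ω) (x : V → Ω) : Option V → Ω := fun o => o.elim y x

/-- weight of a rooted tree -/
def treeW {V Ω : Type*} [Fintype V] (K : Ω → Ω → ℝ) (par : V → Option V) (x : Option V → Ω) : ℝ :=
  ∏ v, K (x (par v)) (x (some v))

/-- rooted tree density -/
def treeEv {Ω : Type*} [MeasurableSpace Ω] (μ : Measure Ω) (K : Ω → Ω → ℝ)
    {V : Type} [Fintype V] (par : V → Option V) (y : Ω) : ℝ :=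
  ∫ x : V → Ω, treeW K par (ext y x) ∂Measure.pi fun _ => μ

section gen
variable {Ω : Type*} [MeasurableSpace Ω] (μ : Measure Ω) (K : Ω → Ω → ℝ)

lemma treeW_meas {V : Type*} [Fintype V] (hKm : Measurable (Function.uncurry K))
    (par : V → Option V) : Measurable (treeW K par) := by
  unfold treeW
  refine Finset.measurable_fun_prod _ fun v _ => ?_
  have h : Measurable fun x : Option V → Ω => (x (par v), x (some v)) :=
    (measurable_pi_apply _).prodMk (measurable_pi_apply _)
  exact hKm.comp h

lemma treeW_bdd {V : Type*} [Fintype V] (M : ℝ) (hK : ∀ x y, 0 ≤ K x y) (hM : ∀ x y, K x y ≤ M)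
    (par : V → Option V) (x : Option V → Ω) : |treeW K par x| ≤ M ^ Fintype.card V := by
  unfold treeW
  rw [abs_of_nonneg (Finset.prod_nonneg fun v _ => hK _ _)]
  calc _ ≤ ∏ v : V, M := Finset.prod_le_prod (fun _ _ => hK _ _) fun _ _ => hM _ _
    _ = _ := by simp

lemma ext_meas {V : Type*} : Measurable fun p : (V → Ω) × Ω => ext p.2 p.1 := by
  refine measurable_pi_lambda _ fun o => ?_
  cases o with
  | none => exact measurable_snd
  | some v => exact (measurable_pi_apply v).comp measurable_fst

lemma integral_option [IsFiniteMeasure μ] {V : Type*} [Fintype V] (f : (Option V → Ω) → ℝ)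
    (hf : Measurable f) (C : ℝ) (hC : ∀ x, |f x| ≤ C) :
    ∫ x, f x ∂(Measure.pi fun _ => μ) = ∫ y, ∫ x : V → Ω, f (ext y x) ∂(Measure.pi fun _ => μ) ∂μ := by
  have h := Measure.pi_map_piOptionEquivProd (β := fun _ : Option V => Ω) (fun _ => μ)
  rw [← h, MeasureTheory.integral_map_equiv]
  have h2 : ∀ p : (V → Ω) × Ω, (MeasurableEquiv.piOptionEquivProd fun _ : Option V => Ω).symm p
      = ext p.2 p.1 := by
    rintro ⟨x, y⟩
    funext o
    cases o <;> rfl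
  simp only [h2]
  rw [integral_prod_symm]
  exact integrable_of_bdd _ (hf.comp ext_meas) C fun p => hC _

lemma integral_sum [IsFiniteMeasure μ] {V V' : Type*} [Fintype V] [Fintype V']
    (f : (V → Ω) → ℝ) (f' : (V' → Ω) → ℝ) :
    ∫ x : V ⊕ V' → Ω, f (fun v => x (.inl v)) * f' (fun v => x (.inr v)) ∂(Measure.pi fun _ => μ) =
     (∫ x, f x ∂(Measure.pi fun _ => μ)) * (∫ x, f' x ∂(Measure.pi fun _ => μ)) := by
  have h := measurePreserving_sumPiEquivProdPi (X := fun _ : V ⊕ V' => Ω) (fun _ => μ)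
  rw [← integral_prod_mul, ← h.integral_comp']
  rfl

/-- parent map for the product -/
def parMul {V V' : Type} (p : V → Option V) (p' : V' → Option V') : V ⊕ V' → Option (V ⊕ V') :=
  Sum.elim (fun v => (p v).map Sum.inl) (fun v => (p' v).map Sum.inr)

/-- parent map for the operator -/
def parOp {V : Type} (p : V → Option V) : Option V → Option (Option V)
  | none => none
  | some v => some (p v)

/-- parent map valid -/
def VPar {V : Type} (p : V → Option V) : Prop :=
  (Function.Injective fun v => s(p v, some v)) ∧ ∀ v, p v ≠ some v

lemma VPar.mul {V V' : Type} {p : V → Option V} {p' : V' → Option V'} (h : VPar p) (h' : VPar p') :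
    VPar (parMul p p') := by
  constructor
  · rintro (v | v) (w | w) hvw
    · have : s(p v, some v) = s(p w, some w) := by
        have hi : Function.Injective (Sym2.map (Option.map (Sum.inl : V → V ⊕ V'))) :=
          Sym2.map.injective (Option.map_injective Sum.inl_injective)
        apply hi
        simpa [parMul] using hvw
      rw [h.1 this]
    · simp [parMul] at hvw
    · simp [parMul] at hvw
    · have : s(p' v, some v) = s(p' w, some w) := by
        have hi : Function.Injective (Sym2.map (Option.map (Sum.inr : V' → V ⊕ V'))) :=
          Sym2.map.injective (Option.map_injective Sum.inr_injective)
        apply hi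
        simpa [parMul] using hvw
      rw [h'.1 this]
  · rintro (v | v) hv
    · apply h.2 v
      simpa [parMul] using hv
    · apply h'.2 v
      simpa [parMul] using hv

lemma VPar.op {V : Type} {p : V → Option V} (h : VPar p) : VPar (parOp p) := by
  constructor
  · rintro (_ | v) (_ | w) hvw
    · rfl
    · simp [parOp] at hvw
    · simp [parOp] at hvw
    · have : s(p v, some v) = s(p w, some w) := by
        have hi : Function.Injective (Sym2.map (some : Option V → Option (Option V))) :=
          Sym2.map.injective (Option.some_injective _)
        apply hi
        simpa [parOp] using hvw
      rw [h.1 this]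
  · rintro (_ | v) hv
    · simp [parOp] at hv
    · apply h.2 v
      simpa [parOp] using hv

lemma treeEv_mul [IsFiniteMeasure μ] {V V' : Type} [Fintype V] [Fintype V'] (p : V → Option V)
    (p' : V' → Option V') (y : Ω) :
    treeEv μ K (parMul p p') y = treeEv μ K p y * treeEv μ K p' y := by
  unfold treeEv
  rw [← integral_sum]
  congr 1
  funext x
  unfold treeW
  rw [Fintype.prod_sum_type]
  congr 1
  · refine Finset.prod_congr rfl fun v _ => ?_
    simp only [parMul, Sum.elim_inl]
    cases p v <;> rfl
  · refine Finset.prod_congr rfl fun v _ => ?_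
    simp only [parMul, Sum.elim_inr]
    cases p' v <;> rfl

lemma treeEv_op [IsFiniteMeasure μ] (hKm : Measurable (Function.uncurry K)) (M : ℝ)
    (hK : ∀ x y, 0 ≤ K x y) (hM : ∀ x y, K x y ≤ M)
    {V : Type} [Fintype V] (p : V → Option V) (y : Ω) :
    treeEv μ K (parOp p) y = ∫ z, K y z * treeEv μ K p z ∂μ := by
  have h1 : treeEv μ K (parOp p) y =
      ∫ x : Option V → Ω, K y (x none) * treeW K p x ∂Measure.pi fun _ => μ := by
    unfold treeEv
    congr 1
    funext x
    unfold treeW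
    rw [Fintype.prod_option]
    rfl
  rw [h1, integral_option μ _ _ (M * M ^ Fintype.card V)]
  · congr 1
    funext z
    unfold treeEv
    rw [← integral_const_mul]
    rfl
  · intro x
    rw [abs_mul, abs_of_nonneg (hK _ _)]
    exact mul_le_mul (hM _ _) (treeW_bdd K M hK hM p x) (abs_nonneg _) ((hK y y).trans (hM y y))
  · exact ((hKm.comp measurable_prodMk_left).comp (measurable_pi_apply _)).mul (treeW_meas K hKm p)

lemma treeEv_meas [IsFiniteMeasure μ] (hKm : Measurable (Function.uncurry K))
    {V : Type} [Fintype V] (p : V → Option V) : Measurable (treeEv μ K p) := by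
  have : StronglyMeasurable (Function.uncurry fun (y : Ω) (x : V → Ω) => treeW K p (ext y x)) := by
    apply Measurable.stronglyMeasurable
    exact (treeW_meas K hKm p).comp (ext_meas.comp measurable_swap)
  exact this.integral_prod_right.measurable

lemma treeEv_bdd [IsFiniteMeasure μ] (M : ℝ)
    (hK : ∀ x y, 0 ≤ K x y) (hM : ∀ x y, K x y ≤ M)
    {V : Type} [Fintype V] (p : V → Option V) : ∃ C, ∀ y, |treeEv μ K p y| ≤ C := by
  refine ⟨M ^ Fintype.card V * (Measure.pi fun _ : V => μ).real Set.univ, fun y => ?_⟩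
  unfold treeEv
  rw [← Real.norm_eq_abs]
  exact norm_integral_le_of_norm_le_const
    (Eventually.of_forall fun x => treeW_bdd K M hK hM p _)

lemma treeEv_int [IsFiniteMeasure μ] (hKm : Measurable (Function.uncurry K)) (M : ℝ)
    (hK : ∀ x y, 0 ≤ K x y) (hM : ∀ x y, K x y ≤ M)
    {V : Type} [Fintype V] (p : V → Option V) :
    ∫ y, treeEv μ K p y ∂μ = ∫ x, treeW K p x ∂Measure.pi fun _ => μ :=
  (integral_option μ _ (treeW_meas K hKm p) _ (treeW_bdd K M hK hM p)).symm

end gen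

/-- uniform measure on `Fin n` -/
def unif (n : ℕ) : Measure (Fin n) := ((n : NNReal)⁻¹) • Measure.count

instance (n : ℕ) : IsFiniteMeasure (unif n) := by unfold unif; infer_instance

lemma unif_singleton (n : ℕ) (i : Fin n) : (unif n).real {i} = (n : ℝ)⁻¹ := by
  simp [unif, measureReal_def]

lemma integral_unif (n : ℕ) (f : Fin n → ℝ) : ∫ i, f i ∂unif n = (∑ i, f i) / n := by
  rw [integral_fintype (Integrable.of_finite)]
  simp [unif_singleton, div_eq_inv_mul, Finset.mul_sum]

lemma homDensityG_eq {n k : ℕ} (β : Fin n → Fin n → ℝ) (F : SimpleGraph (Fin k)) :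
    homDensityG β F = ∫ x : Fin k → Fin n, edgeProd F (fun i j => β (x i) (x j))
      ∂Measure.pi fun _ => unif n := by
  rw [integral_fintype (Integrable.of_finite)]
  have : ∀ x : Fin k → Fin n, (Measure.pi fun _ => unif n).real {x} = ((n : ℝ) ^ k)⁻¹ := by
    intro x
    rw [measureReal_def, Measure.pi_singleton, ENNReal.toReal_prod]
    have := unif_singleton n
    simp only [measureReal_def] at this
    simp [this]
  simp only [this, homDensityG, smul_eq_mul, ← Finset.mul_sum]
  rw [div_eq_inv_mul]

lemma homDensityW_eq {k : ℕ} (W : ℝ → ℝ → ℝ) (F : SimpleGraph (Fin k)) :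
    homDensityW W F = ∫ x : Fin k → ℝ, edgeProd F (fun i j => W (x i) (x j))
      ∂Measure.pi fun _ => volume.restrict I01 := by
  unfold homDensityW
  rw [volume_pi, Measure.restrict_pi_pi]

/-- the simple graph of a parent map -/
def treeG {V : Type} [Fintype V] (p : V → Option V) : SimpleGraph (Fin (Fintype.card (Option V))) :=
  SimpleGraph.fromEdgeSet (Set.range fun v =>
    Sym2.map (Fintype.equivFin (Option V)) s(p v, some v))

lemma edgeProd_treeG {V : Type} [Fintype V] (p : V → Option V) (hp : VPar p)
    (f : Fin (Fintype.card (Option V)) → Fin (Fintype.card (Option V)) → ℝ)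
    (hf : ∀ i j, f i j = f j i) :
    edgeProd (treeG p) f = ∏ v, f (Fintype.equivFin (Option V) (p v))
      (Fintype.equivFin (Option V) (some v)) := by
  classical
  have hinj : Function.Injective fun v => Sym2.map (Fintype.equivFin (Option V)) s(p v, some v) :=
    (Sym2.map.injective (Fintype.equivFin (Option V)).injective).comp hp.1
  have h1 : (treeG p).edgeSet = Set.range fun v =>
    Sym2.map (Fintype.equivFin (Option V)) s(p v, some v) := by
    unfold treeG
    rw [SimpleGraph.edgeSet_fromEdgeSet, sdiff_eq_left, Set.disjoint_left]
    rintro _ ⟨v, rfl⟩ h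
    simp at h
    exact hp.2 v h
  unfold edgeProd
  rw [show (treeG p).edgeFinset = Finset.univ.image (fun v =>
    Sym2.map (Fintype.equivFin (Option V)) s(p v, some v)) from ?_]
  · rw [Finset.prod_image (fun _ _ _ _ h => hinj h)]
    refine Finset.prod_congr rfl fun v _ => ?_
    simp only [sym2Val, Sym2.map_mk, Sym2.lift_mk]
    rw [hf]; ring_nf
    try rw [hf]
  · ext e
    rw [SimpleGraph.mem_edgeFinset, h1]
    simp

lemma integral_treeG {Ω : Type*} [MeasurableSpace Ω] (μ : Measure Ω) [IsFiniteMeasure μ]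
    (K : Ω → Ω → ℝ) (hs : ∀ x y, K x y = K y x)
    {V : Type} [Fintype V] (p : V → Option V) (hp : VPar p) :
    ∫ x : Fin (Fintype.card (Option V)) → Ω, edgeProd (treeG p) (fun i j => K (x i) (x j))
      ∂(Measure.pi fun _ => μ) = ∫ x, treeW K p x ∂Measure.pi fun _ => μ := by
  have h := measurePreserving_piCongrLeft (α := fun _ : Option V => Ω) (fun _ => μ)
    (Fintype.equivFin (Option V)).symm
  rw [← h.integral_comp']
  congr 1
  funext x
  rw [edgeProd_treeG p hp _ fun i j => hs _ _]
  unfold treeW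
  refine Finset.prod_congr rfl fun v _ => ?_
  have h2 : ∀ o, (MeasurableEquiv.piCongrLeft (fun _ : Option V => Ω) (Fintype.equivFin (Option V)).symm) x o
    = x (Fintype.equivFin (Option V) o) := by
    intro o
    obtain ⟨i, rfl⟩ := (Fintype.equivFin (Option V)).symm.surjective o
    rw [MeasurableEquiv.coe_piCongrLeft, Equiv.piCongrLeft_apply_apply, Equiv.apply_symm_apply]
  rw [h2, h2]

end Percolation

namespace Percolation

/-- the algebra of pairs -/
abbrev PA : Type := (∀ n : ℕ, Fin n → ℝ) × (ℝ → ℝ)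

/-- tree pair -/
def treeP (β : ∀ n : ℕ, Fin n → Fin n → ℝ) (W : ℝ → ℝ → ℝ) {V : Type} [Fintype V]
    (p : V → Option V) : PA :=
  (fun n => treeEv (unif n) (β n) p, treeEv (volume.restrict I01) W p)

/-- the submonoid of tree pairs -/
def TSub (β : ∀ n : ℕ, Fin n → Fin n → ℝ) (W : ℝ → ℝ → ℝ) : Submonoid PA where
  carrier := {a | ∃ (V : Type) (_ : Fintype V) (p : V → Option V), VPar p ∧ a = treeP β W p}
  one_mem' := by
    refine ⟨Empty, inferInstance, fun e => e.elim, ⟨fun v => v.elim, fun v => v.elim⟩, ?_⟩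
    have h : ∀ {Ω : Type} [MeasurableSpace Ω] (μ : Measure Ω) [IsFiniteMeasure μ] (K : Ω → Ω → ℝ) (y : Ω),
      treeEv μ K (V := Empty) (fun e => e.elim) y = 1 := by
      intro Ω _ μ _ K y
      simp [treeEv, treeW, measureReal_def]
    unfold treeP
    refine Prod.ext ?_ ?_
    · funext n i; exact (h _ _ _).symm
    · funext x; exact (h _ _ _).symm
  mul_mem' := by
    rintro _ _ ⟨V, i1, p, hp, rfl⟩ ⟨V', i2, p', hp', rfl⟩
    refine ⟨V ⊕ V', inferInstance, parMul p p', hp.mul hp', ?_⟩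
    unfold treeP
    refine Prod.ext ?_ ?_
    · funext n i; exact (treeEv_mul _ _ _ _ _).symm
    · funext x; exact (treeEv_mul _ _ _ _ _).symm

/-- operator on pairs -/
def opP (β : ∀ n : ℕ, Fin n → Fin n → ℝ) (W : ℝ → ℝ → ℝ) (a : PA) : PA :=
  (fun n i => ∫ j, β n i j * a.1 n j ∂unif n, fun x => ∫ y in I01, W x y * a.2 y)

lemma mem_adj_iff (β : ∀ n : ℕ, Fin n → Fin n → ℝ) (W : ℝ → ℝ → ℝ) (a : PA) :
    a ∈ Algebra.adjoin ℝ (TSub β W : Set PA) ↔ a ∈ Submodule.span ℝ (TSub β W : Set PA) := by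
  rw [← Subalgebra.mem_toSubmodule, Algebra.adjoin_eq_span, Submonoid.closure_eq]

section
variable (β : ∀ n : ℕ, Fin n → Fin n → ℝ) (βmax : ℝ)
    (hsym : ∀ n i j, β n i j = β n j i)
    (hnonneg : ∀ n i j, 0 ≤ β n i j)
    (hbound : ∀ n i j, β n i j ≤ βmax)
    (W : ℝ → ℝ → ℝ) (hW : IsGraphon W) (hconv : ConvergesTo β W)

lemma exp_lip {s t : ℝ} (hs : 0 ≤ s) (ht : 0 ≤ t) : |Real.exp (-s) - Real.exp (-t)| ≤ |s - t| := by
  wlog h : s ≤ t generalizing s t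
  · rw [abs_sub_comm, abs_sub_comm s t]; exact this ht hs (by linarith)
  have h1 : Real.exp (-t) ≤ Real.exp (-s) := Real.exp_le_exp.2 (by linarith)
  rw [abs_of_nonneg (by linarith), abs_of_nonpos (by linarith)]
  have h2 : Real.exp (-t) = Real.exp (-s) * Real.exp (s - t) := by rw [← Real.exp_add]; ring_nf
  have h3 := Real.add_one_le_exp (s - t)
  have h4 : Real.exp (-s) ≤ 1 := Real.exp_le_one_iff.2 (by linarith)
  have h5 := Real.exp_pos (-s)
  rw [h2]
  nlinarith

include hW in
lemma adj_bdd (a : PA) (ha : a ∈ Algebra.adjoin ℝ (TSub β W : Set PA)) :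
    Measurable a.2 ∧ ∃ C, ∀ x, |a.2 x| ≤ C := by
  rw [mem_adj_iff] at ha
  obtain ⟨hWm, hW0, hWs, M, hM⟩ := hW
  induction ha using Submodule.span_induction with
  | mem a h =>
    obtain ⟨V, i1, p, hp, rfl⟩ := h
    exact ⟨treeEv_meas _ _ hWm p, treeEv_bdd _ _ M hW0 hM p⟩
  | zero => exact ⟨measurable_const, 0, fun x => by simp⟩
  | add a b _ _ ha hb =>
    obtain ⟨ha1, C, hC⟩ := ha
    obtain ⟨hb1, D, hD⟩ := hb
    exact ⟨ha1.add hb1, C + D, fun x => (abs_add_le _ _).trans (add_le_add (hC x) (hD x))⟩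
  | smul c a _ ha =>
    obtain ⟨ha1, C, hC⟩ := ha
    refine ⟨ha1.const_smul c, |c| * C, fun x => ?_⟩
    show |c * a.2 x| ≤ _
    rw [abs_mul]
    exact mul_le_mul_of_nonneg_left (hC x) (abs_nonneg _)

lemma int_Wf {W : ℝ → ℝ → ℝ} (hWm : Measurable (Function.uncurry W)) {M : ℝ}
    (hW0 : ∀ x y, 0 ≤ W x y) (hM : ∀ x y, W x y ≤ M) (f : ℝ → ℝ)
    (h : Measurable f ∧ ∃ C, ∀ x, |f x| ≤ C) (x : ℝ) :
    Integrable (fun y => W x y * f y) (volume.restrict I01) := by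
  obtain ⟨h1, C, hC⟩ := h
  refine integrable_of_bdd _ ((hWm.comp measurable_prodMk_left).mul h1) (M * C) fun y => ?_
  show |W x y * f y| ≤ _
  rw [abs_mul, abs_of_nonneg (hW0 x y)]
  exact mul_le_mul (hM _ _) (hC _) (abs_nonneg _) ((hW0 x y).trans (hM x y))

include hW hnonneg hbound in
lemma adj_op (a : PA) (ha : a ∈ Algebra.adjoin ℝ (TSub β W : Set PA)) :
    opP β W a ∈ Algebra.adjoin ℝ (TSub β W : Set PA) := by
  have hb := adj_bdd β W hW
  obtain ⟨hWm, hW0, hWs, M, hM⟩ := hW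
  rw [mem_adj_iff] at ha ⊢
  simp only [mem_adj_iff] at hb
  induction ha using Submodule.span_induction with
  | mem a h =>
    obtain ⟨V, i1, p, hp, rfl⟩ := h
    apply Submodule.subset_span
    refine ⟨Option V, inferInstance, parOp p, hp.op, ?_⟩
    refine Prod.ext ?_ ?_
    · funext n i
      exact (treeEv_op (unif n) (β n) (by fun_prop) βmax (hnonneg n) (hbound n) p i).symm
    · funext x
      exact (treeEv_op _ W hWm M hW0 hM p x).symm
  | zero =>
    have : opP β W 0 = 0 := by
      refine Prod.ext ?_ ?_
      · funext n i; simp [opP]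
      · funext n; simp [opP]
    rw [this]; exact Submodule.zero_mem _
  | add a b h1 h2 ha hb' =>
    have : opP β W (a + b) = opP β W a + opP β W b := by
      refine Prod.ext ?_ ?_
      · funext n i
        simp only [opP, Prod.fst_add, Pi.add_apply, mul_add]
        rw [integral_add Integrable.of_finite Integrable.of_finite]
      · funext x
        simp only [opP, Prod.snd_add, Pi.add_apply, mul_add]
        rw [integral_add (int_Wf hWm hW0 hM _ (hb a h1) x) (int_Wf hWm hW0 hM _ (hb b h2) x)]
    rw [this]; exact Submodule.add_mem _ ha hb'
  | smul c a h1 ha =>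
    have : opP β W (c • a) = c • opP β W a := by
      refine Prod.ext ?_ ?_
      · funext n i
        simp only [opP, Prod.smul_fst, Pi.smul_apply, smul_eq_mul, ← integral_const_mul]
        congr 1; funext j; ring
      · funext x
        simp only [opP, Prod.smul_snd, Pi.smul_apply, smul_eq_mul, ← integral_const_mul]
        congr 1; funext j; ring
    rw [this]; exact Submodule.smul_mem _ _ ha

include hW hnonneg hbound hsym hconv in
lemma adj_tendsto (a : PA) (ha : a ∈ Algebra.adjoin ℝ (TSub β W : Set PA)) :
    Tendsto (fun n => ∫ i, a.1 n i ∂unif n) atTop (nhds (∫ x in I01, a.2 x)) := by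
  have hb := adj_bdd β W hW
  obtain ⟨hWm, hW0, hWs, M, hM⟩ := hW
  rw [mem_adj_iff] at ha
  simp only [mem_adj_iff] at hb
  have hint : ∀ a : PA, a ∈ Submodule.span ℝ (TSub β W : Set PA) →
      Integrable a.2 (volume.restrict I01) := fun a ha => by
    obtain ⟨h1, C, hC⟩ := hb a ha
    exact integrable_of_bdd _ h1 C hC
  induction ha using Submodule.span_induction with
  | mem a h =>
    obtain ⟨V, i1, p, hp, rfl⟩ := h
    have h := hconv _ (treeG p)
    rw [homDensityW_eq, integral_treeG _ W hWs p hp, ← treeEv_int _ W hWm M hW0 hM] at h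
    refine h.congr fun n => ?_
    rw [homDensityG_eq, integral_treeG _ (β n) (hsym n) p hp,
      ← treeEv_int _ (β n) (by fun_prop) βmax (hnonneg n) (hbound n)]
    rfl
  | zero => simp
  | add a b h1 h2 ha hb' =>
    have := ha.add hb'
    rw [← integral_add (hint a h1) (hint b h2)] at this
    refine this.congr fun n => ?_
    rw [← integral_add Integrable.of_finite Integrable.of_finite]
    rfl
  | smul c a h1 ha =>
    have := ha.const_mul c
    rw [← integral_const_mul] at this
    refine this.congr fun n => ?_
    rw [← integral_const_mul]
    rfl

lemma unif_univ (n : ℕ) : (unif n).real Set.univ ≤ 1 := by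
  have h := integral_unif n (fun _ => 1)
  simp at h
  rw [h]
  exact div_self_le_one _

lemma T_close {Ω : Type*} [MeasurableSpace Ω] (μ : Measure Ω) [IsFiniteMeasure μ]
    (hμ : μ.real Set.univ ≤ 1) (k : Ω → ℝ) (B : ℝ) (hB0 : 0 ≤ B) (hk : ∀ x, 0 ≤ k x) (hB : ∀ x, k x ≤ B)
    (f g : Ω → ℝ) (hf : Integrable (fun y => k y * f y) μ) (hg : Integrable (fun y => k y * g y) μ)
    (δ : ℝ) (hδ : 0 ≤ δ) (h : ∀ y, |f y - g y| ≤ δ) :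
    |∫ y, k y * f y ∂μ - ∫ y, k y * g y ∂μ| ≤ B * δ := by
  rw [← integral_sub hf hg, ← Real.norm_eq_abs]
  refine (norm_integral_le_of_norm_le_const (C := B * δ) (Eventually.of_forall fun y => ?_)).trans ?_
  · rw [← mul_sub, Real.norm_eq_abs, abs_mul, abs_of_nonneg (hk y)]
    exact mul_le_mul (hB y) (h y) (abs_nonneg _) hB0
  · have : 0 ≤ B * δ := mul_nonneg hB0 hδ
    nlinarith

include hW hnonneg hbound in
lemma approx (r : ℕ) : ∀ ε > 0, ∃ a ∈ Algebra.adjoin ℝ (TSub β W : Set PA),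
    (∀ n i, |a.1 n i - gIt (unif n) (β n) r i| ≤ ε) ∧
    ∀ x, |a.2 x - gIt (volume.restrict I01) W r x| ≤ ε := by
  induction r with
  | zero =>
    intro ε hε
    exact ⟨1, one_mem _, fun n i => by simpa [gIt] using hε.le, fun x => by simpa [gIt] using hε.le⟩
  | succ r ih =>
    intro ε hε
    have hW' := hW
    obtain ⟨hWm, hW0, hWs, M, hM⟩ := hW'
    set B : ℝ := max (max M βmax) 1 with hB
    have hB1 : 1 ≤ B := le_max_right _ _
    have hMB : M ≤ B := (le_max_left _ _).trans (le_max_left _ _)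
    have hbB : βmax ≤ B := (le_max_right _ _).trans (le_max_left _ _)
    obtain ⟨δ, hδ, hδ1, hδε⟩ : ∃ δ > 0, B * δ ≤ 1 ∧ B * δ ≤ ε / 6 := by
      refine ⟨min 1 (ε/6) / B, by positivity, ?_, ?_⟩
      · rw [mul_div_cancel₀ _ (by positivity)]; exact min_le_left _ _
      · rw [mul_div_cancel₀ _ (by positivity)]; exact min_le_right _ _
    obtain ⟨a, ha, ha1, ha2⟩ := ih δ hδ
    obtain ⟨q, hq⟩ := exists_polynomial_near_of_continuousOn (-1) (B + 1)
      (fun t => 1 - Real.exp (-t)) (by fun_prop) (ε / 2) (by positivity)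
    have key : ∀ s t : ℝ, 0 ≤ s → s ≤ B → |t - s| ≤ B * δ →
        |q.eval t - (1 - Real.exp (-s))| ≤ ε := by
      intro s t hs0 hsB hst
      have hst' := abs_le.1 hst
      have h1 := hq t ⟨by linarith, by linarith⟩
      have h2 : |Real.exp (-s) - Real.exp (-t)| ≤ 3 * (B * δ) := by
        have e1 : Real.exp (-s) - Real.exp (-t) =
            Real.exp 1 * (Real.exp (-(s+1)) - Real.exp (-(t+1))) := by
          rw [mul_sub, ← Real.exp_add, ← Real.exp_add]; ring_nf
        rw [e1, abs_mul, abs_of_pos (Real.exp_pos _)]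
        have e2 := exp_lip (s := s + 1) (t := t + 1) (by linarith) (by linarith)
        have e3 : |s + 1 - (t + 1)| = |t - s| := by rw [abs_sub_comm]; ring_nf
        have e4 := Real.exp_one_lt_d9
        exact mul_le_mul (by linarith) (by linarith) (abs_nonneg _) (by norm_num)
      have e5 : q.eval t - (1 - Real.exp (-s)) = (q.eval t - (1 - Real.exp (-t))) +
        (Real.exp (-s) - Real.exp (-t)) := by ring
      rw [e5]
      refine (abs_add_le _ _).trans ?_
      linarith
    refine ⟨Polynomial.aeval (opP β W a) q, ?_, ?_, ?_⟩
    · have := (Polynomial.aeval (⟨_, adj_op β βmax hnonneg hbound W hW a ha⟩ :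
        Algebra.adjoin ℝ (TSub β W : Set PA)) q).2
      rwa [Polynomial.aeval_subalgebra_coe] at this
    · intro n i
      rw [Polynomial.aeval_prod_apply]
      show |(Polynomial.aeval (opP β W a).1) q n i - _| ≤ ε
      rw [Polynomial.aeval_pi_apply₂, Polynomial.aeval_pi_apply₂,
        Polynomial.coe_aeval_eq_eval]
      have h01 := gIt_mem (unif n) (β n) (hnonneg n) r
      have h0 : 0 ≤ ∫ j, β n i j * gIt (unif n) (β n) r j ∂unif n :=
        integral_nonneg fun j => mul_nonneg (hnonneg n i j) (h01 j).1
      have hle : |∫ j, β n i j * gIt (unif n) (β n) r j ∂unif n - ∫ j, β n i j * 0 ∂unif n|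
        ≤ B * 1 :=
        T_close (unif n) (unif_univ n) (β n i) B (by linarith) (hnonneg n i)
          (fun j => (hbound n i j).trans hbB) _ _ Integrable.of_finite Integrable.of_finite 1
          zero_le_one fun j => by rw [sub_zero, abs_of_nonneg (h01 j).1]; exact (h01 j).2
      simp only [mul_zero, integral_zero, sub_zero, mul_one] at hle
      exact key _ _ h0 ((le_abs_self _).trans hle)
        (T_close (unif n) (unif_univ n) (β n i) B (by linarith) (hnonneg n i)
          (fun j => (hbound n i j).trans hbB) _ _ Integrable.of_finite Integrable.of_finite δ
          hδ.le (ha1 n))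
    · intro x
      rw [Polynomial.aeval_prod_apply]
      show |(Polynomial.aeval (opP β W a).2) q x - _| ≤ ε
      rw [Polynomial.aeval_pi_apply₂, Polynomial.coe_aeval_eq_eval]
      have h01 := gIt_mem (volume.restrict I01) W hW0 r
      have hgm := gIt_meas (volume.restrict I01) W hWm r
      have hgi := integrable_Kf (volume.restrict I01) W hWm M hW0 hM hgm h01 x
      have h0 : 0 ≤ ∫ y in I01, W x y * gIt (volume.restrict I01) W r y :=
        integral_nonneg fun y => mul_nonneg (hW0 x y) (h01 y).1
      have hle : |(∫ y in I01, W x y * gIt (volume.restrict I01) W r y) - ∫ y in I01, W x y * 0|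
        ≤ B * 1 :=
        T_close _ I01_real.le (W x) B (by linarith) (hW0 x)
          (fun j => (hM x j).trans hMB) _ _ hgi (by simp) 1
          zero_le_one fun j => by rw [sub_zero, abs_of_nonneg (h01 j).1]; exact (h01 j).2
      simp only [mul_zero, integral_zero, sub_zero, mul_one] at hle
      exact key _ _ h0 ((le_abs_self _).trans hle)
        (T_close _ I01_real.le (W x) B (by linarith) (hW0 x)
          (fun j => (hM x j).trans hMB) _ _ (int_Wf hWm hW0 hM _ (adj_bdd β W hW a ha) x) hgi δ
          hδ.le ha2)

include hW hnonneg hbound hsym hconv in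
lemma gIt_tendsto (r : ℕ) : Tendsto (fun n => (∑ i, gIt (unif n) (β n) r i) / n) atTop
    (nhds (aSeq W r)) := by
  simp only [← integral_unif]
  rw [Metric.tendsto_atTop]
  intro ε hε
  obtain ⟨a, ha, ha1, ha2⟩ := approx β βmax hnonneg hbound W hW r (ε/4) (by positivity)
  have h := adj_tendsto β βmax hsym hnonneg hbound W hW hconv a ha
  rw [Metric.tendsto_atTop] at h
  obtain ⟨N, hN⟩ := h (ε/4) (by positivity)
  refine ⟨N, fun n hn => ?_⟩
  have h1 := hN n hn
  rw [Real.dist_eq] at h1 ⊢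
  have h2 : |∫ i, 1 * a.1 n i ∂unif n - ∫ i, 1 * gIt (unif n) (β n) r i ∂unif n| ≤ 1 * (ε/4) :=
    T_close (unif n) (unif_univ n) (fun _ => 1) 1 zero_le_one (fun _ => zero_le_one)
      (fun _ => le_rfl) _ _ Integrable.of_finite Integrable.of_finite _ (by positivity) (ha1 n)
  have h3 : |(∫ x in I01, 1 * a.2 x) - ∫ x in I01, 1 * gIt (volume.restrict I01) W r x| ≤ 1 * (ε/4) := by
    obtain ⟨b1, C, b2⟩ := adj_bdd β W hW a ha
    obtain ⟨hWm, hW0, hWs, M, hM⟩ := hW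
    refine T_close _ I01_real.le (fun _ => 1) 1 zero_le_one (fun _ => zero_le_one)
      (fun _ => le_rfl) _ _ ?_ ?_ _ (by positivity) ha2
    · exact (integrable_of_bdd _ b1 C b2).const_mul 1
    · refine (integrable_of_bdd _ (gIt_meas (volume.restrict I01) W hWm r) 1 fun x => ?_).const_mul 1
      have h01 := gIt_mem (volume.restrict I01) W hW0 r x
      rw [abs_of_nonneg h01.1]; exact h01.2
  simp only [one_mul] at h2 h3
  unfold aSeq
  rw [abs_le] at h2 h3
  rw [abs_lt] at h1 ⊢
  constructor <;> linarith [h1.1, h1.2, h2.1, h2.2, h3.1, h3.2]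

end
end Percolation

namespace Percolation

section Ex
variable {E : Type*} [Fintype E] [DecidableEq E] (q : E → ℝ)

/-- weight of a configuration -/
def wt (ω : E → Bool) : ℝ := ∏ e, if ω e = true then q e else 1 - q e

/-- expectation -/
def Ex (F : (E → Bool) → ℝ) : ℝ := ∑ ω, wt q ω * F ω

/-- edge indicator -/
def bit (ω : E → Bool) (e : E) : ℝ := if ω e = true then 1 else 0

omit [Fintype E] [DecidableEq E] in
lemma bit_nonneg (ω : E → Bool) (e : E) : 0 ≤ bit ω e := by unfold bit; split_ifs <;> norm_num

lemma wt_nonneg (hq0 : ∀ e, 0 ≤ q e) (hq1 : ∀ e, q e ≤ 1) (ω : E → Bool) : 0 ≤ wt q ω := by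
  unfold wt
  refine Finset.prod_nonneg fun e _ => ?_
  split_ifs
  · exact hq0 e
  · linarith [hq1 e]

lemma Ex_add (F G : (E → Bool) → ℝ) : Ex q (fun ω => F ω + G ω) = Ex q F + Ex q G := by
  simp [Ex, mul_add, Finset.sum_add_distrib]

lemma Ex_sub (F G : (E → Bool) → ℝ) : Ex q (fun ω => F ω - G ω) = Ex q F - Ex q G := by
  simp [Ex, mul_sub, Finset.sum_sub_distrib]

lemma Ex_cmul (c : ℝ) (F : (E → Bool) → ℝ) : Ex q (fun ω => c * F ω) = c * Ex q F := by
  simp only [Ex, Finset.mul_sum]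
  refine Finset.sum_congr rfl fun ω _ => by ring

lemma Ex_sum {ι : Type*} (s : Finset ι) (F : ι → (E → Bool) → ℝ) :
    Ex q (fun ω => ∑ i ∈ s, F i ω) = ∑ i ∈ s, Ex q (F i) := by
  simp only [Ex, Finset.mul_sum]
  rw [Finset.sum_comm]

lemma Ex_mono (hq0 : ∀ e, 0 ≤ q e) (hq1 : ∀ e, q e ≤ 1) {F G : (E → Bool) → ℝ}
    (h : ∀ ω, F ω ≤ G ω) : Ex q F ≤ Ex q G :=
  Finset.sum_le_sum fun ω _ => mul_le_mul_of_nonneg_left (h ω) (wt_nonneg q hq0 hq1 ω)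

lemma Ex_const (c : ℝ) : Ex q (fun _ => c) = c := by
  have h : ∑ ω : E → Bool, wt q ω = 1 := by
    unfold wt
    have := Fintype.prod_sum (fun (e : E) (b : Bool) => if b = true then q e else 1 - q e)
    rw [← this]
    simp
  unfold Ex
  rw [← Finset.sum_mul, h, one_mul]

/-- `F` does not depend on the coordinates in `U` -/
def NoDep {E α : Type*} [DecidableEq E] (F : (E → Bool) → α) (U : Set E) : Prop :=
  ∀ e ∈ U, ∀ ω b, F (Function.update ω e b) = F ω

/-- flip a coordinate -/
def flipE (e : E) : (E → Bool) ≃ (E → Bool) where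
  toFun ω := Function.update ω e (!ω e)
  invFun ω := Function.update ω e (!ω e)
  left_inv ω := by simp
  right_inv ω := by simp

lemma two_sum (e : E) (H : (E → Bool) → ℝ) :
    2 * ∑ ω, H ω = ∑ ω, (H (Function.update ω e true) + H (Function.update ω e false)) := by
  have h1 : ∑ ω, H (flipE e ω) = ∑ ω, H ω := Equiv.sum_comp (flipE e) H
  have h2 : ∑ ω, (H ω + H (flipE e ω)) = 2 * ∑ ω, H ω := by
    rw [Finset.sum_add_distrib, h1]; ring
  rw [← h2]
  refine Finset.sum_congr rfl fun ω _ => ?_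
  show H ω + H (Function.update ω e (!ω e)) = _
  have h3 : Function.update ω e (ω e) = ω := Function.update_eq_self e ω
  cases h : ω e
  · rw [h] at h3; rw [h3, add_comm]; rfl
  · rw [h] at h3; rw [h3]; rfl

lemma wt_update (e : E) (ω : E → Bool) (b : Bool) : wt q (Function.update ω e b) =
    (if b = true then q e else 1 - q e) *
      ∏ e' ∈ Finset.univ.erase e, (if ω e' = true then q e' else 1 - q e') := by
  unfold wt
  rw [← Finset.mul_prod_erase _ _ (Finset.mem_univ e)]
  congr 1
  · simp
  · refine Finset.prod_congr rfl fun e' he' => ?_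
    rw [Function.update_of_ne (Finset.ne_of_mem_erase he')]

lemma Ex_avg (e : E) (F : (E → Bool) → ℝ) : Ex q F = Ex q (fun ω =>
    q e * F (Function.update ω e true) + (1 - q e) * F (Function.update ω e false)) := by
  have h : 2 * Ex q F = 2 * Ex q (fun ω =>
    q e * F (Function.update ω e true) + (1 - q e) * F (Function.update ω e false)) := by
    unfold Ex
    rw [two_sum e, two_sum e]
    refine Finset.sum_congr rfl fun ω _ => ?_
    simp only [wt_update, Function.update_idem]
    simp
    ring
  linarith

lemma Ex_prod {ι : Type*} [DecidableEq ι] (T : Finset ι) (e : ι → E) (he : Set.InjOn e T)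
    (X : ι → (E → Bool) → ℝ)
    (hX : ∀ i ∈ T, NoDep (X i) (e '' T)) (H : (E → Bool) → ℝ) (hH : NoDep H (e '' T)) :
    Ex q (fun ω => H ω * ∏ i ∈ T, (1 - bit ω (e i) * X i ω)) =
    Ex q (fun ω => H ω * ∏ i ∈ T, (1 - q (e i) * X i ω)) := by
  induction T using Finset.induction_on generalizing H with
  | empty => simp
  | insert a T ha ih =>
    have hsub : e '' T ⊆ e '' (insert a T : Finset ι) :=
      Set.image_mono (by simp)
    have hmem : e a ∈ e '' (insert a T : Finset ι) := ⟨a, by simp, rfl⟩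
    have hne : ∀ i ∈ T, e i ≠ e a := by
      intro i hi h
      have := he (by simp [hi]) (by simp) h
      exact ha (this ▸ hi)
    have h1 : Ex q (fun ω => H ω * ∏ i ∈ insert a T, (1 - bit ω (e i) * X i ω)) =
        Ex q (fun ω => (H ω * (1 - q (e a) * X a ω)) * ∏ i ∈ T, (1 - bit ω (e i) * X i ω)) := by
      rw [Ex_avg q (e a)]
      congr 1
      funext ω
      simp only [Finset.prod_insert ha, hH (e a) hmem, hX a (Finset.mem_insert_self _ _) (e a) hmem]
      have h2 : ∀ b, ∏ i ∈ T, (1 - bit (Function.update ω (e a) b) (e i) * X i (Function.update ω (e a) b))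
          = ∏ i ∈ T, (1 - bit ω (e i) * X i ω) := by
        intro b
        refine Finset.prod_congr rfl fun i hi => ?_
        rw [hX i (Finset.mem_insert_of_mem hi) (e a) hmem]
        unfold bit
        rw [Function.update_of_ne (hne i hi)]
      simp only [h2]
      simp [bit]
      ring
    rw [h1, ih (he.mono (by simp)) (fun i hi e' he' => hX i (Finset.mem_insert_of_mem hi) e' (hsub he'))]
    · congr 1; funext ω; rw [Finset.prod_insert ha]; ring
    · intro e' he' ω b
      simp only [hH e' (hsub he'), hX a (Finset.mem_insert_self _ _) e' (hsub he')]

lemma Ex_bit (e : E) (F : (E → Bool) → ℝ) (hF : NoDep F {e}) :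
    Ex q (fun ω => bit ω e * F ω) = q e * Ex q F := by
  rw [Ex_avg q e, ← Ex_cmul]
  congr 1
  funext ω
  simp [bit, hF e rfl]

end Ex

section Pth
variable {V : Type*} [Fintype V] [DecidableEq V]

/-- there is a path of length `r` from `j` avoiding `S` -/
def Pth (ω : Sym2 V → Bool) : ℕ → V → Finset V → Prop
  | 0, _, _ => True
  | r + 1, j, S => ∃ k, k ∉ insert j S ∧ ω s(j, k) = true ∧ Pth ω r k (insert j S)

open Classical in
/-- indicator of `Pth` -/
def XX (r : ℕ) (j : V) (S : Finset V) (ω : Sym2 V → Bool) : ℝ := if Pth ω r j S then 1 else 0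

/-- vertices on paths of length less than `r` from `j` avoiding `S` -/
def Lset (ω : Sym2 V → Bool) : ℕ → V → Finset V → Finset V
  | 0, _, _ => ∅
  | r + 1, j, S => insert j (((insert j S)ᶜ.filter fun k => ω s(j, k) = true).biUnion
      fun k => Lset ω r k (insert j S))

/-- edges touching `S` -/
def touch (S : Finset V) : Set (Sym2 V) := {e | ∃ s ∈ S, s ∈ e}

omit [Fintype V] in
lemma touch_mono {S T : Finset V} (h : S ⊆ T) : touch S ⊆ touch T := by
  rintro e ⟨s, hs, he⟩
  exact ⟨s, h hs, he⟩

omit [Fintype V] in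
lemma not_touch {S : Finset V} {j k : V} (hj : j ∉ S) (hk : k ∉ S) : s(j, k) ∉ touch S := by
  rintro ⟨s, hs, he⟩
  rcases Sym2.mem_iff.1 he with rfl | rfl
  · exact hj hs
  · exact hk hs

omit [Fintype V] in
lemma touch_left {S : Finset V} {j k : V} (hj : j ∈ S) : s(j, k) ∈ touch S := ⟨j, hj, by simp⟩

omit [Fintype V] in
lemma Pth_noDep (r : ℕ) (j : V) (S : Finset V) (hj : j ∉ S) :
    NoDep (fun ω : Sym2 V → Bool => Pth ω r j S) (touch S) := by
  induction r generalizing j S with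
  | zero => intro e _ ω b; rfl
  | succ r ih =>
    intro e he ω b
    simp only [Pth]
    refine propext (exists_congr fun k => and_congr_right fun hk => ?_)
    have hk' : k ∉ S := fun h => hk (Finset.mem_insert_of_mem h)
    have hne : s(j, k) ≠ e := fun h => not_touch hj hk' (h ▸ he)
    have h : Pth (Function.update ω e b) r k (insert j S) = Pth ω r k (insert j S) :=
      ih k (insert j S) hk e (touch_mono (Finset.subset_insert _ _) he) ω b
    rw [Function.update_of_ne hne, h]

lemma Lset_noDep (r : ℕ) (j : V) (S : Finset V) (hj : j ∉ S) :
    NoDep (fun ω : Sym2 V → Bool => Lset ω r j S) (touch S) := by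
  induction r generalizing j S with
  | zero => intro e _ ω b; rfl
  | succ r ih =>
    intro e he ω b
    simp only [Lset]
    congr 1
    ext x
    simp only [Finset.mem_biUnion, Finset.mem_filter, Finset.mem_compl]
    refine exists_congr fun k => ?_
    rw [and_assoc, and_assoc]
    refine and_congr_right fun hk => ?_
    have hk' : k ∉ S := fun h => hk (Finset.mem_insert_of_mem h)
    have hne : s(j, k) ≠ e := fun h => not_touch hj hk' (h ▸ he)
    have h : Lset (Function.update ω e b) r k (insert j S) = Lset ω r k (insert j S) :=
      ih k (insert j S) hk e (touch_mono (Finset.subset_insert _ _) he) ω b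
    rw [Function.update_of_ne hne, h]

omit [Fintype V] in
lemma XX_noDep (r : ℕ) (j : V) (S : Finset V) (hj : j ∉ S) :
    NoDep (XX r j S) (touch S) := by
  intro e he ω b
  have h : Pth (Function.update ω e b) r j S = Pth ω r j S := Pth_noDep r j S hj e he ω b
  unfold XX
  by_cases hp : Pth ω r j S
  · rw [if_pos hp, if_pos (h.symm ▸ hp)]
  · rw [if_neg hp, if_neg (h.symm ▸ hp)]

omit [Fintype V] in
lemma XX_mem (r : ℕ) (j : V) (S : Finset V) (ω : Sym2 V → Bool) : XX r j S ω ∈ Set.Icc (0:ℝ) 1 := by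
  unfold XX; split_ifs <;> simp

lemma XX_succ (r : ℕ) (j : V) (S : Finset V) (ω : Sym2 V → Bool) :
    XX (r + 1) j S ω = 1 - ∏ k ∈ (insert j S)ᶜ, (1 - bit ω s(j, k) * XX r k (insert j S) ω) := by
  by_cases h : Pth ω (r + 1) j S
  · rw [XX, if_pos h]
    obtain ⟨k, hk, hb, hp⟩ := h
    rw [Finset.prod_eq_zero (i := k) (by simpa using hk)]
    · simp
    · simp [bit, XX, hb, hp]
  · rw [XX, if_neg h, Finset.prod_eq_one]
    · simp
    · intro k hk
      rw [Finset.mem_compl] at hk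
      have : ¬ (ω s(j, k) = true ∧ Pth ω r k (insert j S)) := fun h' => h ⟨k, hk, h'⟩
      unfold bit XX
      by_cases h1 : ω s(j, k) = true <;> by_cases h2 : Pth ω r k (insert j S) <;> simp_all

omit [Fintype V] in
lemma Pth_anti (ω : Sym2 V → Bool) (r : ℕ) (j : V) (S T : Finset V) (h : S ⊆ T)
    (hp : Pth ω r j T) : Pth ω r j S := by
  induction r generalizing j S T with
  | zero => trivial
  | succ r ih =>
    obtain ⟨k, hk, hb, hp⟩ := hp
    have := Finset.insert_subset_insert j h
    exact ⟨k, fun hk' => hk (this hk'), hb, ih k _ _ this hp⟩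

omit [Fintype V] in
lemma XX_anti (ω : Sym2 V → Bool) (r : ℕ) (j : V) (S T : Finset V) (h : S ⊆ T) :
    XX r j T ω ≤ XX r j S ω := by
  have := Pth_anti ω r j S T h
  unfold XX
  split_ifs <;> simp_all

lemma XX_diff (ω : Sym2 V → Bool) (r : ℕ) (j u : V) (S : Finset V) :
    XX (r+1) j S ω - XX (r+1) j (insert u S) ω ≤ ∑ k ∈ (insert j S)ᶜ, bit ω s(j, k) *
      (if k = u then 1 else XX r k (insert j S) ω - XX r k (insert u (insert j S)) ω) := by
  have hnn : ∀ k ∈ (insert j S)ᶜ, 0 ≤ bit ω s(j, k) *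
      (if k = u then 1 else XX r k (insert j S) ω - XX r k (insert u (insert j S)) ω) := by
    intro k _
    refine mul_nonneg (bit_nonneg _ _) ?_
    split_ifs
    · exact zero_le_one
    · linarith [XX_anti ω r k (insert j S) _ (Finset.subset_insert u _)]
  by_cases h1 : Pth ω (r + 1) j S
  swap
  · have : XX (r+1) j S ω = 0 := by simp [XX, h1]
    rw [this]
    linarith [(XX_mem (r+1) j (insert u S) ω).1, Finset.sum_nonneg hnn]
  by_cases h2 : Pth ω (r + 1) j (insert u S)
  · have : XX (r+1) j (insert u S) ω = 1 := by simp [XX, h2]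
    rw [this]
    linarith [(XX_mem (r+1) j S ω).2, Finset.sum_nonneg hnn]
  have e2 : XX (r+1) j (insert u S) ω = 0 := by simp [XX, h2]
  have e1 : XX (r+1) j S ω = 1 := by simp [XX, h1]
  obtain ⟨k, hk, hb, hp⟩ := h1
  rw [e1, e2, sub_zero]
  refine le_trans ?_ (Finset.single_le_sum hnn (by simpa using hk : k ∈ (insert j S)ᶜ))
  simp only [bit, hb, if_true, one_mul]
  split_ifs with hku
  · exact le_rfl
  · have e3 : XX r k (insert j S) ω = 1 := by simp [XX, hp]
    have e4 : XX r k (insert u (insert j S)) ω = 0 := by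
      rw [XX, if_neg]
      intro h3
      apply h2
      rw [Finset.insert_comm] at h3
      refine ⟨k, ?_, hb, h3⟩
      simp only [Finset.mem_insert, not_or] at hk ⊢
      exact ⟨hk.1, hku, hk.2⟩
    rw [e3, e4]; norm_num

/-- constants -/
def cc (M : ℝ) : ℕ → ℝ
  | 0 => 0
  | r + 1 => M * (1 + cc M r)

lemma cc_nonneg {M : ℝ} (hM : 0 ≤ M) (r : ℕ) : 0 ≤ cc M r := by
  induction r with
  | zero => exact le_rfl
  | succ r ih => unfold cc; positivity

/-- constants -/
def ll (M : ℝ) : ℕ → ℝ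
  | 0 => 0
  | r + 1 => 1 + M * ll M r

lemma ll_nonneg {M : ℝ} (hM : 0 ≤ M) (r : ℕ) : 0 ≤ ll M r := by
  induction r with
  | zero => exact le_rfl
  | succ r ih => unfold ll; positivity

variable (q : Sym2 V → ℝ) (hq0 : ∀ e, 0 ≤ q e) (hq1 : ∀ e, q e ≤ 1) (M : ℝ) (hM : 0 ≤ M)
  (n : ℝ) (hn : 0 < n) (hcard : (Fintype.card V : ℝ) = n) (hqM : ∀ e, q e ≤ M / n)

include hq0 hq1 hM hn hcard hqM

lemma Ex_diff (r : ℕ) (j u : V) (S : Finset V) (hju : j ≠ u) (hj : j ∉ S) :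
    Ex q (fun ω => XX r j S ω - XX r j (insert u S) ω) ≤ cc M r / n := by
  induction r generalizing j S with
  | zero => simp [XX, Pth, cc, Ex]
  | succ r ih =>
    refine (Ex_mono q hq0 hq1 fun ω => XX_diff ω r j u S).trans ?_
    rw [Ex_sum]
    have h1 : ∀ k ∈ (insert j S)ᶜ, Ex q (fun ω => bit ω s(j, k) *
      (if k = u then 1 else XX r k (insert j S) ω - XX r k (insert u (insert j S)) ω)) ≤
       M / n * ((if k = u then 1 else 0) + cc M r / n) := by
      intro k hk
      rw [Finset.mem_compl] at hk
      have hc : 0 ≤ cc M r / n := div_nonneg (cc_nonneg hM r) hn.le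
      have hMn : 0 ≤ M / n := div_nonneg hM hn.le
      rw [Ex_bit]
      · by_cases hku : k = u
        · simp only [hku, if_true, Ex_const]
          exact mul_le_mul (hqM _) (by linarith) zero_le_one hMn
        · simp only [hku, if_false, zero_add]
          refine (mul_le_mul_of_nonneg_left (ih k (insert j S) hku hk) (hq0 _)).trans ?_
          exact mul_le_mul_of_nonneg_right (hqM _) hc
      · rintro e rfl ω b
        by_cases hku : k = u
        · simp [hku]
        · simp only [hku, if_false]
          rw [XX_noDep r k (insert j S) hk _ (touch_left (Finset.mem_insert_self _ _)),
            XX_noDep r k (insert u (insert j S)) (by simp only [Finset.mem_insert, not_or] at hk ⊢; tauto) _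
            (touch_left (by simp))]
    refine (Finset.sum_le_sum h1).trans ?_
    refine (Finset.sum_le_sum_of_subset_of_nonneg (Finset.subset_univ _) ?_).trans ?_
    · intro k _ _
      have hc : 0 ≤ cc M r / n := div_nonneg (cc_nonneg hM r) hn.le
      have hMn : 0 ≤ M / n := div_nonneg hM hn.le
      refine mul_nonneg hMn (add_nonneg ?_ hc)
      split_ifs <;> norm_num
    · rw [← Finset.mul_sum, Finset.sum_add_distrib]
      simp only [Finset.sum_ite_eq', Finset.mem_univ, if_true, Finset.sum_const, Finset.card_univ,
        nsmul_eq_mul, hcard, cc]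
      rw [mul_div_cancel₀ _ hn.ne']
      exact le_of_eq (by ring)

lemma Ex_Lset (r : ℕ) (j : V) (S : Finset V) (hj : j ∉ S) :
    Ex q (fun ω => ((Lset ω r j S).card : ℝ)) ≤ ll M r := by
  induction r generalizing j S with
  | zero => simp [Lset, ll, Ex]
  | succ r ih =>
    have h0 : ∀ ω : Sym2 V → Bool, ((Lset ω (r+1) j S).card : ℝ) ≤ 1 + ∑ k ∈ (insert j S)ᶜ,
        bit ω s(j, k) * ((Lset ω r k (insert j S)).card : ℝ) := by
      intro ω
      simp only [Lset]
      have h1 := Finset.card_insert_le j (((insert j S)ᶜ.filter fun k => ω s(j, k) = true).biUnion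
        fun k => Lset ω r k (insert j S))
      have h2 := Finset.card_biUnion_le (s := (insert j S)ᶜ.filter fun k => ω s(j, k) = true)
        (t := fun k => Lset ω r k (insert j S))
      have h3 : ((∑ k ∈ (insert j S)ᶜ.filter (fun k => ω s(j, k) = true),
          (Lset ω r k (insert j S)).card : ℕ) : ℝ) = ∑ k ∈ (insert j S)ᶜ,
        bit ω s(j, k) * ((Lset ω r k (insert j S)).card : ℝ) := by
        rw [Finset.sum_filter]
        push_cast
        refine Finset.sum_congr rfl fun k _ => ?_
        unfold bit
        split_ifs <;> simp
      rw [← h3]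
      have h4 := h1.trans (Nat.add_le_add_right h2 1)
      rw [add_comm] at h4
      exact_mod_cast h4
    refine (Ex_mono q hq0 hq1 h0).trans ?_
    rw [Ex_add, Ex_const, Ex_sum, ll]
    refine add_le_add le_rfl ?_
    have h1 : ∀ k ∈ (insert j S)ᶜ, Ex q (fun ω => bit ω s(j, k) *
       ((Lset ω r k (insert j S)).card : ℝ)) ≤ M / n * ll M r := by
      intro k hk
      rw [Finset.mem_compl] at hk
      rw [Ex_bit]
      · exact (mul_le_mul_of_nonneg_left (ih k (insert j S) hk) (hq0 _)).trans
          (mul_le_mul_of_nonneg_right (hqM _) (ll_nonneg hM r))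
      · rintro e rfl ω b
        have h : Lset (Function.update ω s(j, k) b) r k (insert j S) = Lset ω r k (insert j S) :=
          Lset_noDep r k (insert j S) hk _ (touch_left (Finset.mem_insert_self j S) (k := k)) ω b
        show ((Lset (Function.update ω _ b) r k (insert j S)).card : ℝ) = _
        rw [h]
    refine (Finset.sum_le_sum h1).trans ?_
    refine (Finset.sum_le_sum_of_subset_of_nonneg (Finset.subset_univ _) ?_).trans ?_
    · intro k _ _
      exact mul_nonneg (div_nonneg hM hn.le) (ll_nonneg hM r)
    · simp only [Finset.sum_const, Finset.card_univ, nsmul_eq_mul, hcard]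
      rw [← mul_assoc, mul_div_cancel₀ _ hn.ne']

end Pth
end Percolation

namespace Percolation

lemma prod_exp {ι : Type*} [DecidableEq ι] (T : Finset ι) (a : ι → ℝ) (h0 : ∀ i ∈ T, 0 ≤ a i)
    (h1 : ∀ i ∈ T, a i ≤ 1) :
    |∏ i ∈ T, (1 - a i) - Real.exp (-∑ i ∈ T, a i)| ≤ ∑ i ∈ T, a i ^ 2 := by
  induction T using Finset.induction_on with
  | empty => simp
  | insert b T hb ih =>
    have ih := ih (fun i hi => h0 i (Finset.mem_insert_of_mem hi))
      (fun i hi => h1 i (Finset.mem_insert_of_mem hi))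
    rw [Finset.prod_insert hb, Finset.sum_insert hb, Finset.sum_insert hb, neg_add, Real.exp_add]
    have hb0 := h0 b (Finset.mem_insert_self _ _)
    have hb1 := h1 b (Finset.mem_insert_self _ _)
    set P := ∏ i ∈ T, (1 - a i)
    have hE0 : 0 < Real.exp (-∑ i ∈ T, a i) := Real.exp_pos _
    have hE1 : Real.exp (-∑ i ∈ T, a i) ≤ 1 := by
      rw [Real.exp_le_one_iff, neg_nonpos]
      exact Finset.sum_nonneg fun i hi => h0 i (Finset.mem_insert_of_mem hi)
    set E := Real.exp (-∑ i ∈ T, a i)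
    have h3 : |Real.exp (-a b) - 1 - (-a b)| ≤ (-a b) ^ 2 :=
      Real.abs_exp_sub_one_sub_id_le (by rw [abs_neg, abs_of_nonneg hb0]; exact hb1)
    have h4 : (1 - a b) * P - Real.exp (-a b) * E
      = (1 - a b) * (P - E) + (-(Real.exp (-a b) - 1 - (-a b))) * E := by ring
    rw [h4]
    refine (abs_add_le _ _).trans ?_
    rw [abs_mul, abs_mul, abs_neg, abs_of_nonneg (by linarith : 0 ≤ 1 - a b), abs_of_pos hE0]
    have h5 : (1 - a b) * |P - E| ≤ 1 * |P - E| :=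
      mul_le_mul_of_nonneg_right (by linarith) (abs_nonneg _)
    have h6 : |Real.exp (-a b) - 1 - (-a b)| * E ≤ |Real.exp (-a b) - 1 - (-a b)| * 1 :=
      mul_le_mul_of_nonneg_left hE1 (abs_nonneg _)
    nlinarith

lemma Ex_abs {E : Type*} [Fintype E] [DecidableEq E] (q : E → ℝ) (hq0 : ∀ e, 0 ≤ q e)
    (hq1 : ∀ e, q e ≤ 1) (F : (E → Bool) → ℝ) : |Ex q F| ≤ Ex q (fun ω => |F ω|) := by
  unfold Ex
  refine (Finset.abs_sum_le_sum_abs _ _).trans (Finset.sum_le_sum fun ω _ => ?_)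
  rw [abs_mul, abs_of_nonneg (wt_nonneg q hq0 hq1 ω)]

lemma Ex_swap {V : Type*} [Fintype V] [DecidableEq V] (q : Sym2 V → ℝ) (r : ℕ) (j : V)
    (S : Finset V) (c : ℝ) (H : (Sym2 V → Bool) → ℝ) (hH : NoDep H (touch {j})) :
    Ex q (fun ω => H ω * (XX (r+1) j S ω - c)) =
    Ex q (fun ω => H ω * ((1 - ∏ k ∈ (insert j S)ᶜ, (1 - q s(j, k) * XX r k (insert j S) ω)) - c)) := by
  have hsub : (fun k => s(j, k)) '' ((insert j S)ᶜ : Finset V) ⊆ touch {j} := by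
    rintro _ ⟨k, _, rfl⟩
    exact touch_left (by simp)
  have h := Ex_prod q (insert j S)ᶜ (fun k => s(j, k)) (by
    intro a _ b _ hab
    have h : s(j, a) = s(j, b) := hab
    rcases Sym2.eq_iff.1 h with h | h
    · exact h.2
    · exact h.2.trans h.1) (fun k => XX r k (insert j S)) (by
    intro k hk e he
    exact XX_noDep r k (insert j S) (by simpa using hk) e
      (touch_mono (by simp) (hsub he))) H (fun e he => hH e (hsub he))
  have e1 : (fun ω => H ω * (XX (r+1) j S ω - c)) = fun ω => (1 - c) * H ω -
     H ω * ∏ k ∈ (insert j S)ᶜ, (1 - bit ω s(j, k) * XX r k (insert j S) ω) := by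
    funext ω; rw [XX_succ]; ring
  have e2 : (fun ω => H ω * ((1 - ∏ k ∈ (insert j S)ᶜ, (1 - q s(j, k) * XX r k (insert j S) ω)) - c))
     = fun ω => (1 - c) * H ω -
     H ω * ∏ k ∈ (insert j S)ᶜ, (1 - q s(j, k) * XX r k (insert j S) ω) := by
    funext ω; ring
  rw [e1, e2, Ex_sub, Ex_sub, h]

lemma gIt_succ_unif (n : ℕ) (β : Fin n → Fin n → ℝ) (r : ℕ) (j : Fin n) :
    gIt (unif n) β (r+1) j = 1 - Real.exp (-((∑ k, β j k * gIt (unif n) β r k) / n)) := by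
  show 1 - Real.exp (-∫ y, β j y * gIt (unif n) β r y ∂(unif n)) = _
  rw [integral_unif]

lemma pi_bound (n : ℕ) (β : Fin n → Fin n → ℝ) (M : ℝ) (hβ0 : ∀ i j, 0 ≤ β i j)
    (hβM : ∀ i j, β i j ≤ M) (hM : 1 ≤ M) (hn : M ≤ n) (r : ℕ) (j : Fin n) (T : Finset (Fin n))
    (s : ℕ) (hT : T.card ≤ s) (X : Fin n → ℝ) (hX : ∀ k, X k ∈ Set.Icc (0:ℝ) 1) :
    |(1 - ∏ k ∈ Tᶜ, (1 - β j k / n * X k)) - gIt (unif n) β (r+1) j| ≤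
      (M^2 + s * M) / n + M * |(∑ k ∈ Tᶜ, (β j k / M) * (X k - gIt (unif n) β r k)) / n| := by
  have hn0 : (0:ℝ) < n := by linarith
  have hg : ∀ k, gIt (unif n) β r k ∈ Set.Icc (0:ℝ) 1 := fun k => gIt_mem (unif n) β hβ0 r k
  have hb0 : ∀ k, 0 ≤ β j k / n := fun k => div_nonneg (hβ0 _ _) hn0.le
  have hb1 : ∀ k, β j k / n ≤ M / n := fun k => div_le_div_of_nonneg_right (hβM _ _) hn0.le
  have hMn : M / n ≤ 1 := by rw [div_le_one hn0]; exact hn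
  have ha0 : ∀ k, 0 ≤ β j k / n * X k := fun k => mul_nonneg (hb0 k) (hX k).1
  have ha1 : ∀ k, β j k / n * X k ≤ M / n := fun k =>
    (mul_le_of_le_one_right (hb0 k) (hX k).2).trans (hb1 k)
  rw [gIt_succ_unif]
  have h1 := prod_exp Tᶜ (fun k => β j k / n * X k) (fun k _ => ha0 k) (fun k _ => (ha1 k).trans hMn)
  have h2 : ∑ k ∈ Tᶜ, (β j k / n * X k) ^ 2 ≤ M ^ 2 / n := by
    calc ∑ k ∈ Tᶜ, (β j k / n * X k) ^ 2 ≤ ∑ k ∈ Tᶜ, (M / n) ^ 2 :=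
          Finset.sum_le_sum fun k _ => pow_le_pow_left₀ (ha0 k) (ha1 k) 2
      _ ≤ ∑ k : Fin n, (M / n) ^ 2 :=
          Finset.sum_le_sum_of_subset_of_nonneg (Finset.subset_univ _) fun _ _ _ => by positivity
      _ = M ^ 2 / n := by
          simp only [Finset.sum_const, Finset.card_univ, Fintype.card_fin, nsmul_eq_mul]
          field_simp
  have h3 := exp_lip (s := ∑ k ∈ Tᶜ, β j k / n * X k) (t := (∑ k, β j k * gIt (unif n) β r k) / n)
    (Finset.sum_nonneg fun k _ => ha0 k)
    (div_nonneg (Finset.sum_nonneg fun k _ => mul_nonneg (hβ0 _ _) (hg k).1) hn0.le)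
  have h4 : ∑ k ∈ Tᶜ, β j k / n * X k - (∑ k, β j k * gIt (unif n) β r k) / n
     = M * ((∑ k ∈ Tᶜ, (β j k / M) * (X k - gIt (unif n) β r k)) / n)
       - ∑ k ∈ T, β j k / n * gIt (unif n) β r k := by
    rw [← Finset.sum_add_sum_compl T, add_div, Finset.sum_div, Finset.sum_div, Finset.sum_div,
      Finset.mul_sum]
    have e1 : ∑ k ∈ T, β j k * gIt (unif n) β r k / n = ∑ k ∈ T, β j k / n * gIt (unif n) β r k :=
      Finset.sum_congr rfl fun k _ => by ring
    have e2 : ∑ k ∈ Tᶜ, M * (β j k / M * (X k - gIt (unif n) β r k) / n) =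
       ∑ k ∈ Tᶜ, β j k / n * X k - ∑ k ∈ Tᶜ, β j k * gIt (unif n) β r k / n := by
      rw [← Finset.sum_sub_distrib]
      refine Finset.sum_congr rfl fun k _ => ?_
      have : M ≠ 0 := by linarith
      field_simp
    rw [e1, e2]; ring
  have h5 : |∑ k ∈ T, β j k / n * gIt (unif n) β r k| ≤ s * M / n := by
    rw [abs_of_nonneg (Finset.sum_nonneg fun k _ => mul_nonneg (hb0 k) (hg k).1)]
    calc ∑ k ∈ T, β j k / n * gIt (unif n) β r k ≤ ∑ k ∈ T, M / n :=
          Finset.sum_le_sum fun k _ => (mul_le_of_le_one_right (hb0 k) (hg k).2).trans (hb1 k)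
      _ = T.card * (M / n) := by simp
      _ ≤ s * (M / n) := mul_le_mul_of_nonneg_right (by exact_mod_cast hT) (by positivity)
      _ = s * M / n := by ring
  rw [h4] at h3
  have h6 := abs_sub (M * ((∑ k ∈ Tᶜ, (β j k / M) * (X k - gIt (unif n) β r k)) / n))
    (∑ k ∈ T, β j k / n * gIt (unif n) β r k)
  rw [abs_mul, abs_of_nonneg (by linarith : 0 ≤ M)] at h6
  set A := ∏ k ∈ Tᶜ, (1 - β j k / n * X k)
  set B := Real.exp (-∑ k ∈ Tᶜ, β j k / n * X k)
  set C := Real.exp (-((∑ k, β j k * gIt (unif n) β r k) / n))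
  have h7 : 1 - A - (1 - C) = -(A - B) - (B - C) := by ring
  rw [h7]
  have h8 := abs_sub (-(A - B)) (B - C)
  rw [abs_neg] at h8
  rw [add_div]
  linarith

/-- normalized weighted sum -/
def Zs (n : ℕ) (β : Fin n → Fin n → ℝ) (r : ℕ) (S : Finset (Fin n)) (w : Fin n → ℝ)
    (ω : Sym2 (Fin n) → Bool) : ℝ :=
  (∑ j ∈ Sᶜ, w j * (XX r j S ω - gIt (unif n) β r j)) / n

/-- constants -/
def KK (M : ℝ) : ℕ → ℕ → ℝ
  | 0, _ => 0
  | r + 1, s => 1 + 2 * cc M (r+1) + 2 * (M^2 + (s + 2 : ℕ) * M)^2 + 2 * M^2 * KK M r (s+2)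

lemma KK_nonneg {M : ℝ} (hM : 0 ≤ M) (r s : ℕ) : 0 ≤ KK M r s := by
  induction r generalizing s with
  | zero => exact le_rfl
  | succ r ih => unfold KK; have := ih (s+2); have := cc_nonneg hM (r+1); positivity

lemma conc (n : ℕ) (β : Fin n → Fin n → ℝ) (M : ℝ) (hβ0 : ∀ i j, 0 ≤ β i j)
    (hβM : ∀ i j, β i j ≤ M) (hM : 1 ≤ M) (hn : M ≤ n) (q : Sym2 (Fin n) → ℝ)
    (hq : ∀ i j, q s(i, j) = β i j / n) (r s : ℕ) (S : Finset (Fin n)) (hS : S.card ≤ s)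
    (w : Fin n → ℝ) (hw : ∀ j, |w j| ≤ 1) :
    Ex q (fun ω => Zs n β r S w ω ^ 2) ≤ KK M r s / n := by
  have hn0 : (0:ℝ) < n := by linarith
  have hn1 : (1:ℝ) ≤ n := by linarith
  have hM0 : 0 ≤ M := by linarith
  have hq0 : ∀ e, 0 ≤ q e := by
    intro e; induction e with | _ i j => rw [hq]; exact div_nonneg (hβ0 _ _) hn0.le
  have hqM : ∀ e, q e ≤ M / n := by
    intro e; induction e with | _ i j => rw [hq]; exact div_le_div_of_nonneg_right (hβM _ _) hn0.le
  have hq1 : ∀ e, q e ≤ 1 := fun e => (hqM e).trans (by rw [div_le_one hn0]; exact hn)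
  induction r generalizing s S w with
  | zero =>
    have : ∀ ω, Zs n β 0 S w ω = 0 := by intro ω; simp [Zs, XX, Pth, gIt]
    simp [this, KK, Ex_const]
  | succ r ih =>
    set g := gIt (unif n) β (r+1) with hgdef
    have hg : ∀ k, g k ∈ Set.Icc (0:ℝ) 1 := fun k => gIt_mem (unif n) β hβ0 (r+1) k
    have hD : ∀ j S ω, |XX (r+1) j S ω - g j| ≤ 1 := by
      intro j S ω
      have h1 := XX_mem (r+1) j S ω
      have h2 := hg j
      rw [abs_le]
      constructor <;> linarith [h1.1, h1.2, h2.1, h2.2]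
    set B : ℝ := 2 * cc M (r+1) + 2 * (M^2 + (s + 2 : ℕ) * M)^2 + 2 * M^2 * KK M r (s+2) with hB
    -- bound for each `π`
    have hpi : ∀ (j : Fin n) (T : Finset (Fin n)), T.card ≤ s + 2 →
        Ex q (fun ω => ((1 - ∏ k ∈ Tᶜ, (1 - q s(j, k) * XX r k T ω)) - g j) ^ 2) ≤
        (2 * (M^2 + (s + 2 : ℕ) * M)^2 + 2 * M^2 * KK M r (s+2)) / n := by
      intro j T hT
      have hpt : ∀ ω, ((1 - ∏ k ∈ Tᶜ, (1 - q s(j, k) * XX r k T ω)) - g j) ^ 2 ≤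
          2 * (M^2 + (s + 2 : ℕ) * M)^2 / n + 2 * M ^ 2 * Zs n β r T (fun k => β j k / M) ω ^ 2 := by
        intro ω
        have h := pi_bound n β M hβ0 hβM hM hn r j T (s+2) hT (fun k => XX r k T ω)
          (fun k => XX_mem r k T ω)
        simp only [hq]
        rw [← sq_abs]
        have h1 := pow_le_pow_left₀ (abs_nonneg _) h 2
        refine h1.trans ?_
        have h2 : ((M^2 + (s + 2 : ℕ) * M) / n) ^ 2 ≤ (M^2 + (s + 2 : ℕ) * M) ^ 2 / n := by
          rw [div_pow]
          refine div_le_div_of_nonneg_left (by positivity) hn0 (by nlinarith)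
        have h3 := add_sq_le (a := (M^2 + (s + 2 : ℕ) * M) / n)
          (b := M * |(∑ k ∈ Tᶜ, (β j k / M) * (XX r k T ω - gIt (unif n) β r k)) / n|)
        rw [mul_pow, sq_abs] at h3
        refine h3.trans ?_
        unfold Zs
        rw [mul_add, mul_div_assoc, mul_assoc 2 (M^2)]
        linarith
      refine (Ex_mono q hq0 hq1 hpt).trans ?_
      rw [Ex_add, Ex_const, Ex_cmul, add_div]
      refine add_le_add le_rfl ?_
      rw [mul_div_assoc]
      refine mul_le_mul_of_nonneg_left ?_ (by positivity)
      refine ih (s+2) T hT _ fun k => ?_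
      rw [abs_of_nonneg (div_nonneg (hβ0 _ _) hM0), div_le_one (by linarith)]
      exact hβM _ _
    -- off-diagonal terms
    have hoff : ∀ j ∈ Sᶜ, ∀ j' ∈ Sᶜ, j ≠ j' →
        |Ex q (fun ω => (XX (r+1) j S ω - g j) * (XX (r+1) j' S ω - g j'))| ≤ B / n := by
      intro j hj j' hj' hjj'
      rw [Finset.mem_compl] at hj hj'
      have hjS : j ∉ insert j' S := by simp [hjj', hj]
      have hjS' : j' ∉ insert j S := by simp [hjj'.symm, hj']
      set T := insert j (insert j' S) with hT
      have hT' : insert j' (insert j S) = T := Finset.insert_comm _ _ _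
      have hTc : T.card ≤ s + 2 := by
        have h1 : T.card ≤ (insert j' S).card + 1 := Finset.card_insert_le j (insert j' S)
        have h2 := Finset.card_insert_le j' S
        omega
      have hst : Ex q (fun ω => (XX (r+1) j' (insert j S) ω - g j') * (XX (r+1) j (insert j' S) ω - g j))
          = Ex q (fun ω => ((1 - ∏ k ∈ Tᶜ, (1 - q s(j, k) * XX r k T ω)) - g j) *
             ((1 - ∏ k ∈ Tᶜ, (1 - q s(j', k) * XX r k T ω)) - g j')) := by
        rw [Ex_swap q r j (insert j' S) (g j) (fun ω => XX (r+1) j' (insert j S) ω - g j')]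
        · have e1 : (fun ω => (XX (r+1) j' (insert j S) ω - g j') *
              ((1 - ∏ k ∈ (insert j (insert j' S))ᶜ, (1 - q s(j, k) * XX r k (insert j (insert j' S)) ω)) - g j))
             = (fun ω => ((1 - ∏ k ∈ Tᶜ, (1 - q s(j, k) * XX r k T ω)) - g j) *
               (XX (r+1) j' (insert j S) ω - g j')) := by
            funext ω; ring
          rw [e1, Ex_swap q r j' (insert j S) (g j')
            (fun ω => (1 - ∏ k ∈ Tᶜ, (1 - q s(j, k) * XX r k T ω)) - g j), hT']
          intro e he ω b
          have : ∀ k ∈ Tᶜ, XX r k T (Function.update ω e b) = XX r k T ω := by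
            intro k hk
            exact XX_noDep r k T (by simpa using hk) e (touch_mono (by simp [hT]) he) ω b
          show _ - _ = _ - _
          congr 2
          exact Finset.prod_congr rfl fun k hk => by rw [this k hk]
        · intro e he ω b
          have := XX_noDep (r+1) j' (insert j S) hjS' e (touch_mono (by simp) he) ω b
          show _ - _ = _ - _
          rw [this]
      have hst2 : |Ex q (fun ω => (XX (r+1) j' (insert j S) ω - g j') * (XX (r+1) j (insert j' S) ω - g j))|
          ≤ (2 * (M^2 + (s + 2 : ℕ) * M)^2 + 2 * M^2 * KK M r (s+2)) / n := by
        rw [hst]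
        refine (Ex_abs q hq0 hq1 _).trans ?_
        refine (Ex_mono q hq0 hq1 (G := fun ω => (1/2) *
          ((1 - ∏ k ∈ Tᶜ, (1 - q s(j, k) * XX r k T ω)) - g j) ^ 2 +
          (1/2) * ((1 - ∏ k ∈ Tᶜ, (1 - q s(j', k) * XX r k T ω)) - g j') ^ 2) ?_).trans ?_
        · intro ω
          rw [abs_le]
          constructor <;> nlinarith [sq_nonneg ((1 - ∏ k ∈ Tᶜ, (1 - q s(j, k) * XX r k T ω)) - g j
            - ((1 - ∏ k ∈ Tᶜ, (1 - q s(j', k) * XX r k T ω)) - g j')),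
            sq_nonneg ((1 - ∏ k ∈ Tᶜ, (1 - q s(j, k) * XX r k T ω)) - g j
            + ((1 - ∏ k ∈ Tᶜ, (1 - q s(j', k) * XX r k T ω)) - g j'))]
        · rw [Ex_add, Ex_cmul, Ex_cmul]
          linarith [hpi j T hTc, hpi j' T hTc]
      have hd1 := Ex_diff q hq0 hq1 M hM0 n hn0 (by simp) hqM (r+1) j j' S hjj' hj
      have hd2 := Ex_diff q hq0 hq1 M hM0 n hn0 (by simp) hqM (r+1) j' j S hjj'.symm hj'
      have e3 : (fun ω => (XX (r+1) j S ω - g j) * (XX (r+1) j' S ω - g j')) = fun ω =>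
         ((XX (r+1) j S ω - g j) * (XX (r+1) j' S ω - g j') -
           (XX (r+1) j' (insert j S) ω - g j') * (XX (r+1) j (insert j' S) ω - g j)) +
           (XX (r+1) j' (insert j S) ω - g j') * (XX (r+1) j (insert j' S) ω - g j) := by
        funext ω; ring
      rw [e3, Ex_add]
      refine (abs_add_le _ _).trans ?_
      have hB' : B / n = (cc M (r+1) / n + cc M (r+1) / n) +
        (2 * (M^2 + (s + 2 : ℕ) * M)^2 + 2 * M^2 * KK M r (s+2)) / n := by rw [hB]; ring
      rw [hB']
      refine add_le_add ?_ hst2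
      refine (Ex_abs q hq0 hq1 _).trans ?_
      refine (Ex_mono q hq0 hq1 (G := fun ω => (XX (r+1) j S ω - XX (r+1) j (insert j' S) ω) +
        (XX (r+1) j' S ω - XX (r+1) j' (insert j S) ω)) ?_).trans ?_
      · intro ω
        have e4 : (XX (r+1) j S ω - g j) * (XX (r+1) j' S ω - g j') -
           (XX (r+1) j' (insert j S) ω - g j') * (XX (r+1) j (insert j' S) ω - g j)
           = (XX (r+1) j S ω - XX (r+1) j (insert j' S) ω) * (XX (r+1) j' S ω - g j') +
            (XX (r+1) j (insert j' S) ω - g j) * (XX (r+1) j' S ω - XX (r+1) j' (insert j S) ω) := by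
          ring
        rw [e4]
        refine (abs_add_le _ _).trans ?_
        have h1 := XX_anti ω (r+1) j S _ (Finset.subset_insert j' S)
        have h2 := XX_anti ω (r+1) j' S _ (Finset.subset_insert j S)
        rw [abs_mul, abs_mul, abs_of_nonneg (sub_nonneg.2 h1), abs_of_nonneg (sub_nonneg.2 h2)]
        exact add_le_add (mul_le_of_le_one_right (sub_nonneg.2 h1) (hD _ _ _))
          (mul_le_of_le_one_left (sub_nonneg.2 h2) (hD _ _ _))
      · rw [Ex_add]
        exact add_le_add hd1 hd2
    have hB0 : 0 ≤ B := by
      have := KK_nonneg hM0 r (s+2)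
      have := cc_nonneg hM0 (r+1)
      positivity
    have hall : ∀ j ∈ Sᶜ, ∀ j' ∈ Sᶜ,
        (w j * w j') * Ex q (fun ω => (XX (r+1) j S ω - g j) * (XX (r+1) j' S ω - g j')) ≤
          (if j = j' then 1 else 0) + B / n := by
      intro j hj j' hj'
      have hww : |w j * w j'| ≤ 1 := by
        rw [abs_mul]; exact mul_le_one₀ (hw j) (abs_nonneg _) (hw j')
      refine (le_abs_self _).trans ?_
      rw [abs_mul]
      refine (mul_le_of_le_one_left (abs_nonneg _) hww).trans ?_
      split_ifs with h
      · refine le_trans ?_ (le_add_of_nonneg_right (div_nonneg hB0 hn0.le))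
        refine (Ex_abs q hq0 hq1 _).trans ?_
        refine (Ex_mono q hq0 hq1 (G := fun _ => 1) ?_).trans (Ex_const q 1).le
        intro ω
        rw [abs_mul]
        exact mul_le_one₀ (hD _ _ _) (abs_nonneg _) (hD _ _ _)
      · rw [zero_add]; exact hoff j hj j' hj' h
    have hexp : (fun ω => Zs n β (r+1) S w ω ^ 2) = fun ω => (1 / (n:ℝ)^2) * ∑ j ∈ Sᶜ, ∑ j' ∈ Sᶜ,
        (w j * w j') * ((XX (r+1) j S ω - g j) * (XX (r+1) j' S ω - g j')) := by
      funext ω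
      unfold Zs
      rw [div_pow, pow_two (∑ j ∈ Sᶜ, _), Finset.sum_mul_sum, div_eq_inv_mul, one_div]
      congr 1
      refine Finset.sum_congr rfl fun j _ => Finset.sum_congr rfl fun j' _ => by ring
    rw [hexp, Ex_cmul, Ex_sum]
    simp only [Ex_sum, Ex_cmul]
    have hfin : ∑ j ∈ Sᶜ, ∑ j' ∈ Sᶜ, (w j * w j') * Ex q (fun ω => (XX (r+1) j S ω - g j) * (XX (r+1) j' S ω - g j'))
        ≤ n * (1 + B) := by
      have hn' : ((Sᶜ).card : ℝ) ≤ n := by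
        have := Finset.card_le_univ Sᶜ
        rw [Fintype.card_fin] at this
        exact_mod_cast this
      have hrow : ∀ j ∈ Sᶜ, ∑ j' ∈ Sᶜ, (w j * w j') * Ex q (fun ω => (XX (r+1) j S ω - g j) * (XX (r+1) j' S ω - g j'))
          ≤ 1 + B := by
        intro j hj
        refine (Finset.sum_le_sum fun j' hj' => hall j hj j' hj').trans ?_
        rw [Finset.sum_add_distrib, Finset.sum_ite_eq, if_pos hj, Finset.sum_const, nsmul_eq_mul]
        have : ((Sᶜ).card : ℝ) * (B / n) ≤ n * (B / n) :=
          mul_le_mul_of_nonneg_right hn' (div_nonneg hB0 hn0.le)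
        rw [mul_div_cancel₀ _ hn0.ne'] at this
        linarith
      refine (Finset.sum_le_sum hrow).trans ?_
      rw [Finset.sum_const, nsmul_eq_mul]
      exact mul_le_mul_of_nonneg_right hn' (by linarith)
    refine (mul_le_mul_of_nonneg_left hfin (by positivity)).trans (le_of_eq ?_)
    have : KK M (r+1) s = 1 + B := by rw [hB, KK]; ring
    rw [this]
    field_simp

end Percolation

namespace Percolation

section comb
variable {V : Type*} [Fintype V] [DecidableEq V] (ω : Sym2 V → Bool)

lemma graphOf_adj (i j : V) : (graphOf ω).Adj i j ↔ i ≠ j ∧ ω s(i, j) = true := by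
  unfold graphOf
  rw [SimpleGraph.fromRel_adj, Sym2.eq_swap (a := j) (b := i), or_self]

lemma Pth_reach (r : ℕ) (j : V) (S : Finset V) (hj : j ∉ S) (h : Pth ω r j S) :
    ∃ T : Finset V, T.card = r + 1 ∧ Disjoint T S ∧ ∀ t ∈ T, (graphOf ω).Reachable j t := by
  induction r generalizing j S with
  | zero =>
    refine ⟨{j}, by simp, by simpa using hj, ?_⟩
    intro t ht
    rw [Finset.mem_singleton.1 ht]
  | succ r ih =>
    obtain ⟨k, hk, hb, hp⟩ := h
    obtain ⟨T, hT, hd, hr⟩ := ih k (insert j S) hk hp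
    rw [Finset.disjoint_insert_right] at hd
    refine ⟨insert j T, ?_, ?_, ?_⟩
    · rw [Finset.card_insert_of_notMem hd.1, hT]
    · rw [Finset.disjoint_insert_left]; exact ⟨hj, hd.2⟩
    · intro t ht
      rcases Finset.mem_insert.1 ht with rfl | ht
      · exact SimpleGraph.Reachable.refl _
      · have hadj : (graphOf ω).Adj j k := by
          rw [graphOf_adj]
          refine ⟨?_, hb⟩
          rintro rfl
          exact hk (Finset.mem_insert_self _ _)
        exact hadj.reachable.trans (hr t ht)

lemma Pth_size (r : ℕ) (j : V) (h : Pth ω r j ∅) : r < compSize (graphOf ω) j := by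
  obtain ⟨T, hT, _, hr⟩ := Pth_reach ω r j ∅ (by simp) h
  have h1 : (T : Set V) ⊆ {w | (graphOf ω).Reachable j w} := fun t ht => hr t ht
  have h2 := Set.ncard_le_ncard h1 (Set.toFinite _)
  rw [Set.ncard_coe_finset, hT] at h2
  exact h2

lemma walk_Lset {j w : V} (p : (graphOf ω).Walk j w) (hp : p.IsPath) (r : ℕ) (S : Finset V)
    (hS : ∀ x ∈ p.support, x ∉ S) (h : ¬ Pth ω r j S) : w ∈ Lset ω r j S := by
  induction p generalizing r S with
  | nil =>
    cases r with
    | zero => exact absurd trivial h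
    | succ r => simp [Lset]
  | @cons j k w hadj p ih =>
    cases r with
    | zero => exact absurd trivial h
    | succ r =>
      rw [SimpleGraph.Walk.cons_isPath_iff] at hp
      rw [graphOf_adj] at hadj
      have hkS : k ∉ S := hS k (by simp)
      have hk : k ∉ insert j S := by
        simp [hkS, hadj.1.symm]
      have := ih hp.1 r (insert j S) (by
        intro x hx hx'
        rcases Finset.mem_insert.1 hx' with rfl | h'
        · exact hp.2 hx
        · exact hS x (by simp [hx]) h') (fun h' => h ⟨k, hk, hadj.2, h'⟩)
      simp only [Lset, Finset.mem_insert, Finset.mem_biUnion, Finset.mem_filter, Finset.mem_compl]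
      exact Or.inr ⟨k, ⟨by simpa using hk, hadj.2⟩, this⟩

lemma size_le_Lset (r : ℕ) (j : V) (h : ¬ Pth ω r j ∅) :
    compSize (graphOf ω) j ≤ (Lset ω r j ∅).card := by
  have h1 : {w | (graphOf ω).Reachable j w} ⊆ (Lset ω r j ∅ : Set V) := by
    intro w hw
    obtain ⟨p, hp⟩ := SimpleGraph.Reachable.exists_isPath hw
    exact walk_Lset ω p hp r ∅ (by simp) h
  have h2 := Set.ncard_le_ncard h1 (Set.toFinite _)
  rwa [Set.ncard_coe_finset] at h2

open Classical in
lemma NkGT_eq (K : ℕ) : (NkGT (graphOf ω) K : ℝ) =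
    ∑ j : V, if K < compSize (graphOf ω) j then (1:ℝ) else 0 := by
  unfold NkGT
  rw [Set.ncard_eq_toFinset_card']
  simp

lemma NkGT_lower (r : ℕ) : ∑ j : V, XX r j ∅ ω ≤ (NkGT (graphOf ω) r : ℝ) := by
  classical
  rw [NkGT_eq]
  refine Finset.sum_le_sum fun j _ => ?_
  by_cases h : Pth ω r j ∅
  · rw [if_pos (Pth_size ω r j h)]; exact (XX_mem r j ∅ ω).2
  · rw [XX, if_neg h]; split_ifs <;> norm_num

lemma NkGT_upper (r K : ℕ) (hK : 0 < K) : (NkGT (graphOf ω) K : ℝ) ≤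
    ∑ j : V, XX r j ∅ ω + (∑ j : V, ((Lset ω r j ∅).card : ℝ)) / K := by
  classical
  have hK' : (0:ℝ) < K := by exact_mod_cast hK
  rw [NkGT_eq, Finset.sum_div, ← Finset.sum_add_distrib]
  refine Finset.sum_le_sum fun j _ => ?_
  have hL : (0:ℝ) ≤ ((Lset ω r j ∅).card : ℝ) / K := by positivity
  by_cases h : Pth ω r j ∅
  · rw [XX, if_pos h]; split_ifs <;> linarith
  · rw [XX, if_neg h, zero_add]
    split_ifs with h1
    · rw [le_div_iff₀ hK', one_mul]
      exact_mod_cast h1.le.trans (size_le_Lset ω r j h)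
    · exact hL

lemma NkGT_anti {K L : ℕ} (h : K ≤ L) : (NkGT (graphOf ω) L : ℝ) ≤ NkGT (graphOf ω) K := by
  classical
  rw [NkGT_eq, NkGT_eq]
  refine Finset.sum_le_sum fun j _ => ?_
  split_ifs with h1 h2 h2
  · exact le_rfl
  · omega
  · norm_num
  · exact le_rfl

end comb

lemma bern_singleton (p : ℝ) (b : Bool) :
    bern p {b} = ENNReal.ofReal (if b = true then p else 1 - p) := by
  cases b <;> simp [bern]

instance (p : ℝ) : IsFiniteMeasure (bern p) := by
  refine ⟨?_⟩
  simp [bern]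

lemma perc_le {V : Type*} [Fintype V] [DecidableEq V] (β : V → V → ℝ) (p : ℝ)
    (q : Sym2 V → ℝ) (hq : ∀ e, q e = min (p * sym2Val β e) 1)
    (hq0 : ∀ e, 0 ≤ q e) (A : Set (Sym2 V → Bool)) (F : (Sym2 V → Bool) → ℝ)
    (hF0 : ∀ ω, 0 ≤ F ω) (hF1 : ∀ ω ∈ A, 1 ≤ F ω) :
    percMeasure β p A ≤ ENNReal.ofReal (Ex q F) := by
  classical
  have hq1 : ∀ e, q e ≤ 1 := fun e => (hq e) ▸ min_le_right _ _
  have hs : ∀ ω : Sym2 V → Bool, percMeasure β p {ω} = ENNReal.ofReal (wt q ω) := by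
    intro ω
    unfold percMeasure wt
    rw [Measure.pi_singleton, ENNReal.ofReal_prod_of_nonneg]
    · refine Finset.prod_congr rfl fun e _ => ?_
      rw [bern_singleton, hq e]
    · intro e _
      split_ifs
      · exact hq0 e
      · linarith [hq1 e]
  have h1 : percMeasure β p A = ∑ ω ∈ Finset.univ.filter (· ∈ A), percMeasure β p {ω} := by
    rw [sum_measure_singleton]
    congr 1
    ext; simp
  rw [h1, Ex, ENNReal.ofReal_sum_of_nonneg fun ω _ => mul_nonneg (wt_nonneg q hq0 hq1 ω) (hF0 ω)]
  refine (Finset.sum_le_sum fun ω hω => ?_).trans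
    (Finset.sum_le_sum_of_subset (Finset.filter_subset (· ∈ A) Finset.univ))
  rw [hs]
  refine ENNReal.ofReal_le_ofReal ?_
  exact le_mul_of_one_le_right (wt_nonneg q hq0 hq1 ω) (hF1 ω (Finset.mem_filter.1 hω).2)

end Percolation

namespace Percolation

section fin
variable (β : ∀ n : ℕ, Fin n → Fin n → ℝ) (βmax : ℝ)
    (hsym : ∀ n i j, β n i j = β n j i)
    (hnonneg : ∀ n i j, 0 ≤ β n i j)
    (hbound : ∀ n i j, β n i j ≤ βmax)

/-- proportion of vertices starting a path of length `r` -/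
def RR (n r : ℕ) (ω : Sym2 (Fin n) → Bool) : ℝ := (∑ j, XX r j ∅ ω) / n

/-- edge probabilities -/
def qq (n : ℕ) (e : Sym2 (Fin n)) : ℝ := min (1 / n * sym2Val (β n) e) 1

include hsym in
lemma sym2Val_mk (n : ℕ) (i j : Fin n) : sym2Val (β n) s(i, j) = β n i j := by
  simp only [sym2Val, Sym2.lift_mk]
  rw [hsym n j i]; ring

include hsym hnonneg in
lemma qq_nonneg (n : ℕ) (e : Sym2 (Fin n)) : 0 ≤ qq β n e := by
  induction e with
  | _ i j =>
    unfold qq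
    rw [sym2Val_mk β hsym]
    exact le_min (mul_nonneg (by positivity) (hnonneg _ _ _)) zero_le_one

include hsym hbound in
lemma qq_eq (n : ℕ) (hn : max βmax 1 ≤ n) (i j : Fin n) : qq β n s(i, j) = β n i j / n := by
  unfold qq
  have hn0 : (0:ℝ) < n := by linarith [le_max_right βmax 1]
  rw [sym2Val_mk β hsym, one_div_mul_eq_div]
  refine min_eq_left ?_
  rw [div_le_one hn0]
  exact ((hbound n i j).trans (le_max_left _ _)).trans hn

include hsym hnonneg hbound in
lemma RR_tendsto (W : ℝ → ℝ → ℝ) (hW : IsGraphon W) (hconv : ConvergesTo β W) (r : ℕ) (δ : ℝ)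
    (hδ : 0 < δ) : Tendsto (fun n : ℕ => percMeasure (β n) (1 / n)
      {ω | δ ≤ |RR n r ω - aSeq W r|}) atTop (nhds 0) := by
  set M := max βmax 1 with hM
  have hg := gIt_tendsto β βmax hsym hnonneg hbound W hW hconv r
  have hg' : ∀ᶠ n : ℕ in atTop, |(∑ i, gIt (unif n) (β n) r i) / n - aSeq W r| < δ / 2 := by
    have := Metric.tendsto_nhds.1 hg (δ / 2) (by linarith)
    simpa [Real.dist_eq] using this
  have hlim : Tendsto (fun n : ℕ => ENNReal.ofReal ((4 / δ ^ 2) * (KK M r 0 / n))) atTop (nhds 0) := by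
    rw [← ENNReal.ofReal_zero]
    refine ENNReal.tendsto_ofReal ?_
    have := (tendsto_const_div_atTop_nhds_zero_nat (KK M r 0)).const_mul (4 / δ ^ 2)
    rwa [mul_zero] at this
  refine tendsto_of_tendsto_of_tendsto_of_le_of_le' tendsto_const_nhds hlim
    (Eventually.of_forall fun _ => bot_le) ?_
  filter_upwards [hg', tendsto_natCast_atTop_atTop.eventually_ge_atTop M] with n h1 h2
  have hc := conc n (β n) M (hnonneg n) (fun i j => (hbound n i j).trans (le_max_left _ _))
    (le_max_right _ _) h2 (qq β n) (qq_eq β βmax hsym hbound n h2) r 0 ∅ (by simp) (fun _ => 1)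
    (by simp)
  refine (perc_le (β n) (1 / n) (qq β n) (fun _ => rfl) (qq_nonneg β hsym hnonneg n) _
    (fun ω => (4 / δ^2) * Zs n (β n) r ∅ (fun _ => 1) ω ^ 2) (fun ω => by positivity) ?_).trans ?_
  · intro ω hω
    have hω : δ ≤ |RR n r ω - aSeq W r| := hω
    have hz : Zs n (β n) r ∅ (fun _ => 1) ω = RR n r ω - (∑ i, gIt (unif n) (β n) r i) / n := by
      simp [Zs, RR, sub_div, Finset.sum_sub_distrib]
    have h3 : δ / 2 ≤ |Zs n (β n) r ∅ (fun _ => 1) ω| := by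
      rw [hz]
      have := abs_sub_le (RR n r ω) ((∑ i, gIt (unif n) (β n) r i) / n) (aSeq W r)
      linarith
    have h4 := pow_le_pow_left₀ (by linarith) h3 2
    rw [sq_abs] at h4
    rw [div_mul_eq_mul_div, le_div_iff₀ (by positivity)]
    linarith
  · rw [Ex_cmul]
    exact ENNReal.ofReal_le_ofReal (mul_le_mul_of_nonneg_left hc (by positivity))

include hsym hnonneg hbound in
lemma Lset_markov (n : ℕ) (hn : max βmax 1 ≤ n) (r K : ℕ) (hK : 0 < K) (δ : ℝ) (hδ : 0 < δ) :
    percMeasure (β n) (1 / n)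
      {ω | δ ≤ ((∑ j : Fin n, ((Lset ω r j ∅).card : ℝ)) / K) / n} ≤
    ENNReal.ofReal ((ll (max βmax 1) r / δ) / K) := by
  have hn0 : (0:ℝ) < n := by linarith [le_max_right βmax 1]
  have hK' : (0:ℝ) < K := by exact_mod_cast hK
  have hqM : ∀ e, qq β n e ≤ max βmax 1 / n := by
    intro e; induction e with
    | _ i j =>
      rw [qq_eq β βmax hsym hbound n hn]
      exact div_le_div_of_nonneg_right ((hbound n i j).trans (le_max_left _ _)) hn0.le
  refine (perc_le (β n) (1 / n) (qq β n) (fun _ => rfl) (qq_nonneg β hsym hnonneg n) _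
    (fun ω => (1 / (δ * K * n)) * ∑ j : Fin n, ((Lset ω r j ∅).card : ℝ))
    (fun ω => by positivity) ?_).trans ?_
  · intro ω hω
    have hω : δ ≤ ((∑ j : Fin n, ((Lset ω r j ∅).card : ℝ)) / K) / n := hω
    rw [div_div, le_div_iff₀ (by positivity)] at hω
    rw [one_div_mul_eq_div, le_div_iff₀ (by positivity)]
    linarith
  · refine ENNReal.ofReal_le_ofReal ?_
    rw [Ex_cmul, Ex_sum]
    have h1 : ∑ j : Fin n, Ex (qq β n) (fun ω => ((Lset ω r j ∅).card : ℝ)) ≤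
        ∑ j : Fin n, ll (max βmax 1) r :=
      Finset.sum_le_sum fun j _ => Ex_Lset (qq β n) (qq_nonneg β hsym hnonneg n)
        (fun e => min_le_right _ _) _ (by linarith [le_max_right βmax 1]) n hn0 (by simp) hqM r j ∅
        (by simp)
    rw [Finset.sum_const, Finset.card_univ, Fintype.card_fin, nsmul_eq_mul] at h1
    refine (mul_le_mul_of_nonneg_left h1 (by positivity)).trans (le_of_eq ?_)
    field_simp

end fin
end Percolation

open Percolation MeasureTheory Filter Topology in
/-- If `(G_n)` converges to a graphon `W`, then there is a function
`ω₀(n) → ∞` such that for every `ω(n) → ∞` with `ω ≤ ω₀`, the number of vertices of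
`G_n(1/n)` in components with more than `ω(n)` vertices satisfies
`N_{>ω}/n → ρ(W)` in probability. -/
theorem vertices_in_large_components
    (β : ∀ n : ℕ, Fin n → Fin n → ℝ) (βmax : ℝ)
    (hsym : ∀ n i j, β n i j = β n j i)
    (hnonneg : ∀ n i j, 0 ≤ β n i j)
    (hdiag : ∀ n i, β n i i = 0)
    (hbound : ∀ n i j, β n i j ≤ βmax)
    (W : ℝ → ℝ → ℝ) (hW : IsGraphon W) (hconv : ConvergesTo β W) :
    ∃ ω₀ : ℕ → ℕ, Tendsto ω₀ atTop atTop ∧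
      ∀ ω : ℕ → ℕ, Tendsto ω atTop atTop → (∀ n, ω n ≤ ω₀ n) →
        ∀ ε > 0, Tendsto
          (fun n : ℕ => percMeasure (β n) (1 / n)
            {ωs | ε ≤ |(NkGT (graphOf ωs) (ω n) : ℝ) / n - survival W|})
          atTop (nhds 0) := by
  obtain ⟨hρ1, hρ2⟩ := survival_spec W hW
  set P : ∀ n : ℕ, Measure (Sym2 (Fin n) → Bool) := fun n => percMeasure (β n) (1 / n) with hP
  have hR := RR_tendsto β βmax hsym hnonneg hbound W hW hconv
  let good : ℕ → ℕ → Prop := fun n r =>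
    P n {ω | (1 / ((r:ℝ) + 1)) ≤ |RR n r ω - aSeq W r|} ≤ ENNReal.ofReal (1 / ((r:ℝ) + 1))
  have hgood : ∀ r, ∀ᶠ n in atTop, good n r := by
    intro r
    have hr : (0:ℝ) < 1 / ((r:ℝ) + 1) := by positivity
    exact (ENNReal.tendsto_nhds_zero.1 (hR r _ hr)) _ (ENNReal.ofReal_pos.2 hr)
  classical
  let ω₀ : ℕ → ℕ := fun n => Nat.findGreatest (good n) n
  have hω₀ : Tendsto ω₀ atTop atTop := by
    rw [tendsto_atTop]
    intro m
    filter_upwards [hgood m, eventually_ge_atTop m] with n h1 h2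
    exact Nat.le_findGreatest h2 h1
  refine ⟨ω₀, hω₀, ?_⟩
  intro ω hω hle ε hε
  have hspec : ∀ᶠ n in atTop, good n (ω₀ n) := by
    filter_upwards [hgood 1, eventually_ge_atTop 1] with n h1 h2
    exact Nat.findGreatest_spec h2 h1
  obtain ⟨r, hr⟩ : ∃ r, aSeq W r < survival W + ε / 3 :=
    (hρ2.eventually_lt_const (by linarith)).exists
  have hlim1 : Tendsto (fun n => 1 / ((ω₀ n : ℝ) + 1)) atTop (nhds 0) :=
    tendsto_one_div_add_atTop_nhds_zero_nat.comp hω₀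
  have hlim1' : Tendsto (fun n => ENNReal.ofReal (1 / ((ω₀ n : ℝ) + 1))) atTop (nhds 0) := by
    rw [← ENNReal.ofReal_zero]; exact ENNReal.tendsto_ofReal hlim1
  have hlim3 : Tendsto (fun K : ℕ => ENNReal.ofReal ((ll (max βmax 1) r / (ε / 3)) / K)) atTop (nhds 0) := by
    rw [← ENNReal.ofReal_zero]
    exact ENNReal.tendsto_ofReal (tendsto_const_div_atTop_nhds_zero_nat _)
  rw [ENNReal.tendsto_nhds_zero]
  intro η hη
  have hη3 : 0 < η / 3 := ENNReal.div_pos hη.ne' (by norm_num)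
  obtain ⟨K, hK1, hK0⟩ := ((ENNReal.tendsto_nhds_zero.1 hlim3 _ hη3).and
    (eventually_gt_atTop 0)).exists
  filter_upwards [hspec, hlim1.eventually_lt_const hε, ENNReal.tendsto_nhds_zero.1 hlim1' _ hη3,
    ENNReal.tendsto_nhds_zero.1 (hR r (ε / 3) (by linarith)) _ hη3,
    hω.eventually_ge_atTop K,
    tendsto_natCast_atTop_atTop.eventually_ge_atTop (max βmax 1)] with n h1 h2 h3 h4 h5 h6
  have hn0 : (0:ℝ) < n := by linarith [le_max_right βmax 1]
  have hL := Lset_markov β βmax hsym hnonneg hbound n h6 r K hK0 (ε / 3) (by linarith)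
  have hsub : {ωs | ε ≤ |(NkGT (graphOf ωs) (ω n) : ℝ) / n - survival W|} ⊆
      ({ωs | (1 / ((ω₀ n : ℝ) + 1)) ≤ |RR n (ω₀ n) ωs - aSeq W (ω₀ n)|} ∪
       {ωs | ε / 3 ≤ |RR n r ωs - aSeq W r|}) ∪
       {ωs | ε / 3 ≤ ((∑ j : Fin n, ((Lset ωs r j ∅).card : ℝ)) / K) / n} := by
    intro ωs hs
    have hs : ε ≤ |(NkGT (graphOf ωs) (ω n) : ℝ) / n - survival W| := hs
    rcases le_abs.1 hs with hs | hs
    · have e1 : (NkGT (graphOf ωs) (ω n) : ℝ) / n ≤ RR n r ωs +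
          ((∑ j : Fin n, ((Lset ωs r j ∅).card : ℝ)) / K) / n := by
        unfold RR
        rw [← add_div]
        exact div_le_div_of_nonneg_right
          ((NkGT_anti ωs h5).trans (NkGT_upper ωs r K hK0)) hn0.le
      by_cases h : ε / 3 ≤ ((∑ j : Fin n, ((Lset ωs r j ∅).card : ℝ)) / K) / n
      · exact Or.inr h
      · refine Or.inl (Or.inr ?_)
        show ε / 3 ≤ |RR n r ωs - aSeq W r|
        refine le_trans ?_ (le_abs_self _)
        linarith [not_le.1 h]
    · refine Or.inl (Or.inl ?_)
      show (1 / ((ω₀ n : ℝ) + 1)) ≤ |RR n (ω₀ n) ωs - aSeq W (ω₀ n)|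
      have e1 : RR n (ω₀ n) ωs ≤ (NkGT (graphOf ωs) (ω n) : ℝ) / n :=
        div_le_div_of_nonneg_right ((NkGT_lower ωs (ω₀ n)).trans (NkGT_anti ωs (hle n))) hn0.le
      refine le_trans ?_ (neg_le_abs _)
      linarith [hρ1 (ω₀ n)]
  calc percMeasure (β n) (1 / n) {ωs | ε ≤ |(NkGT (graphOf ωs) (ω n) : ℝ) / n - survival W|}
      ≤ _ := measure_mono hsub
    _ ≤ _ := measure_union_le _ _
    _ ≤ (η / 3 + η / 3) + η / 3 := by
        refine add_le_add ((measure_union_le _ _).trans (add_le_add (h1.trans h3) h4)) (hL.trans hK1)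
    _ = η := ENNReal.add_thirds η
end
end

section
/- Let W be an irreducible graphon, and let 0 < a < 1/2. Then there exists b = b(W,a) > 0 such that W has no (a,b)-cut: there is no Lebesgue-measurable set A ⊆ [0,1] with a ≤ μ(A) ≤ 1−a such that ∫_{A×([0,1]∖A)} W(x,y) dx dy ≤ b. -/
open MeasureTheory Filter Topology

noncomputable section

theorem weak_subseq (ν : Measure ℝ) [IsFiniteMeasure ν] [MeasureTheory.IsSeparable ν] (A : ℕ → Set ℝ)
    (hA : ∀ n, MeasurableSet (A n)) :
    ∃ (f : ℝ → ℝ) (φ : ℕ → ℕ), Measurable f ∧ (∀ x, 0 ≤ f x) ∧ (∀ x, f x ≤ 1) ∧ StrictMono φ ∧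
      ∀ h : ℝ → ℝ, Measurable h → (∃ M : ℝ, ∀ x, |h x| ≤ M) →
        Tendsto (fun n => ∫ x in A (φ n), h x ∂ν) atTop (𝓝 (∫ x, f x * h x ∂ν)) := by
  have : Fact ((1 : ENNReal) ≤ 2) := ⟨by norm_num⟩
  have : Fact ((2 : ENNReal) ≠ ⊤) := ⟨by norm_num⟩
  let u : ℕ → Lp ℝ 2 ν := fun n => indicatorConstLp 2 (hA n) (measure_ne_top ν _) (1 : ℝ)
  have hu : ∀ n, ‖u n‖ ≤ (ν.real Set.univ) ^ (1 / (2 : ENNReal).toReal) := by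
    intro n
    refine (norm_indicatorConstLp_le).trans ?_
    simp only [norm_one, one_mul]
    exact Real.rpow_le_rpow measureReal_nonneg (measureReal_mono (Set.subset_univ _)) (by norm_num)
  let D : ℕ → WeakDual ℝ (Lp ℝ 2 ν) := fun n =>
    StrongDual.toWeakDual (InnerProductSpace.toDual ℝ (Lp ℝ 2 ν) (u n))
  obtain ⟨d, -, φ, hφ, hd⟩ := (WeakDual.isSeqCompact_closedBall ℝ (Lp ℝ 2 ν) 0
    ((ν.real Set.univ) ^ (1 / (2 : ENNReal).toReal))) (x := D) (by
      intro n
      simp only [Set.mem_preimage, mem_closedBall_zero_iff]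
      exact ((InnerProductSpace.toDual ℝ (Lp ℝ 2 ν)).norm_map (u n)).le.trans (hu n))
  let g : Lp ℝ 2 ν := (InnerProductSpace.toDual ℝ (Lp ℝ 2 ν)).symm (WeakDual.toStrongDual d)
  have hg : ∀ v : Lp ℝ 2 ν, Tendsto (fun n => inner ℝ (u (φ n)) v) atTop (𝓝 (inner ℝ g v)) := by
    intro v
    have h1 := ((WeakDual.eval_continuous v).tendsto d).comp hd
    have h2 : inner ℝ g v = d v := by
      simp only [g, InnerProductSpace.toDual_symm_apply]; rfl
    rw [h2]
    exact h1
  have hlim : ∀ h : ℝ → ℝ, Measurable h → (∃ M : ℝ, ∀ x, |h x| ≤ M) →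
        Tendsto (fun n => ∫ x in A (φ n), h x ∂ν) atTop (𝓝 (∫ x, g x * h x ∂ν)) := by
    rintro h hm ⟨M, hM⟩
    have hL : MemLp h 2 ν := MemLp.of_bound hm.aestronglyMeasurable M
      (Eventually.of_forall fun x => hM x)
    have := hg hL.toLp
    convert this using 1
    · funext n
      rw [L2.inner_indicatorConstLp_one]
      exact (integral_congr_ae (ae_restrict_of_ae hL.coeFn_toLp)).symm
    · congr 1
      rw [L2.inner_def]
      apply integral_congr_ae
      filter_upwards [hL.coeFn_toLp] with x hx
      rw [hx]; simp [mul_comm]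
  have hgi : Integrable g ν := (Lp.memLp g).integrable (by norm_num)
  have hset : ∀ s, MeasurableSet s → Tendsto (fun n => ν.real (s ∩ A (φ n))) atTop
      (𝓝 (∫ x in s, g x ∂ν)) := by
    intro s hs
    have := hlim (s.indicator 1) (measurable_one.indicator hs) ⟨1, fun x => by
      by_cases hx : x ∈ s <;> simp [hx]⟩
    convert this using 1
    · funext n
      rw [integral_indicator_one hs, measureReal_restrict_apply hs]
    · rw [← integral_indicator hs]
      congr 2
      funext x
      by_cases hx : x ∈ s <;> simp [hx]
  have h0 : 0 ≤ᵐ[ν] g := ae_nonneg_of_forall_setIntegral_nonneg hgi fun s hs _ =>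
    ge_of_tendsto' (hset s hs) fun n => measureReal_nonneg
  have h1 : 0 ≤ᵐ[ν] fun x => 1 - g x := by
    refine ae_nonneg_of_forall_setIntegral_nonneg ((integrable_const 1).sub hgi) fun s hs _ => ?_
    rw [integral_sub (integrable_const 1) hgi.integrableOn]
    have := le_of_tendsto' (hset s hs) (b := ν.real s) fun n =>
      measureReal_mono Set.inter_subset_left
    simp
    linarith
  refine ⟨fun x => max 0 (min (g x) 1), φ, ?_, fun x => le_max_left _ _, fun x => by simp, hφ, ?_⟩
  · have := (Lp.stronglyMeasurable g).measurable
    fun_prop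
  · intro h hm hb
    convert hlim h hm hb using 2
    apply integral_congr_ae
    filter_upwards [h0, h1] with x hx0 hx1
    simp only [Pi.zero_apply] at hx0 hx1
    rw [min_eq_left (by linarith), max_eq_right hx0]

theorem cut_limit (ν : Measure ℝ) [IsFiniteMeasure ν] (B : ℕ → Set ℝ)
    (hB : ∀ n, MeasurableSet (B n)) (f : ℝ → ℝ) (hf : Measurable f) (hf0 : ∀ x, 0 ≤ f x)
    (hf1 : ∀ x, f x ≤ 1)
    (hlim : ∀ h : ℝ → ℝ, Measurable h → (∃ M : ℝ, ∀ x, |h x| ≤ M) →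
        Tendsto (fun n => ∫ x in B n, h x ∂ν) atTop (𝓝 (∫ x, f x * h x ∂ν)))
    (W : ℝ → ℝ → ℝ) (hW : Measurable (Function.uncurry W)) (M : ℝ)
    (hM : ∀ x y, |W x y| ≤ M) :
    Tendsto (fun n => ∫ x in B n, ∫ y in (B n)ᶜ, W x y ∂ν ∂ν) atTop
      (𝓝 (∫ x, f x * (∫ y, (1 - f y) * W x y ∂ν) ∂ν)) := by
  have hWx : ∀ x, Measurable (W x) := fun x => hW.of_uncurry_left
  have hWi : ∀ x, Integrable (W x) ν := fun x =>
    Integrable.of_bound (hWx x).aestronglyMeasurable M (Eventually.of_forall (hM x))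
  have hbd : ∀ (μ : Measure ℝ) [IsFiniteMeasure μ] (F : ℝ → ℝ), μ.real Set.univ ≤ ν.real Set.univ →
      (∀ y, |F y| ≤ M) → |∫ y, F y ∂μ| ≤ M * ν.real Set.univ := by
    intro μ _ F hμ hF
    have h1 := norm_integral_le_of_norm_le_const (μ := μ) (f := F) (C := M)
      (Eventually.of_forall hF)
    have hM0 : 0 ≤ M := (abs_nonneg _).trans (hF 0)
    exact h1.trans (by gcongr)
  have hle : ∀ s : Set ℝ, (ν.restrict s).real Set.univ ≤ ν.real Set.univ := by
    intro s
    simp only [measureReal_restrict_apply MeasurableSet.univ]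
    exact measureReal_mono (Set.inter_subset_left)
  set g : ℝ → ℝ := fun x => ∫ y, (1 - f y) * W x y ∂ν with hg
  set G : ℕ → ℝ → ℝ := fun n x => ∫ y in (B n)ᶜ, W x y ∂ν with hG
  have hgm : Measurable g := by
    have : Measurable (Function.uncurry fun x y => (1 - f y) * W x y) := by
      have h1 : Measurable fun p : ℝ × ℝ => (1 - f p.2) * Function.uncurry W p := by fun_prop
      exact h1
    exact (this.stronglyMeasurable.integral_prod_right (ν := ν)).measurable
  have hGm : ∀ n, Measurable (G n) := fun n =>
    (hW.stronglyMeasurable.integral_prod_right (ν := ν.restrict (B n)ᶜ)).measurable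
  have hgb : ∀ x, |g x| ≤ M * ν.real Set.univ := by
    intro x
    refine hbd ν _ le_rfl fun y => ?_
    rw [abs_mul]
    have : |1 - f y| ≤ 1 := abs_le.2 ⟨by linarith [hf1 y], by linarith [hf0 y]⟩
    nlinarith [hM x y, abs_nonneg (W x y)]
  have hGb : ∀ n x, |G n x| ≤ M * ν.real Set.univ := fun n x => hbd _ _ (hle _) (hM x)
  have hgi : Integrable g ν :=
    Integrable.of_bound hgm.aestronglyMeasurable _ (Eventually.of_forall hgb)
  have hGi : ∀ n, Integrable (G n) ν := fun n =>
    Integrable.of_bound (hGm n).aestronglyMeasurable _ (Eventually.of_forall (hGb n))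
  have hptw : ∀ x, Tendsto (fun n => G n x) atTop (𝓝 (g x)) := by
    intro x
    have h1 := (hlim (W x) (hWx x) ⟨M, hM x⟩).const_sub (∫ y, W x y ∂ν)
    have hfi : Integrable (fun y => f y * W x y) ν := by
      refine (hWi x).bdd_mul (c := 1) hf.aestronglyMeasurable (Eventually.of_forall fun y => ?_)
      rw [Real.norm_eq_abs, abs_of_nonneg (hf0 y)]; exact hf1 y
    convert h1 using 1
    · funext n
      have := integral_add_compl (hB n) (hWi x)
      simp only [hG]; linarith
    · rw [← integral_sub (hWi x) hfi]
      simp only [hg]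
      congr 2; funext y; ring
  have hL1 : Tendsto (fun n => ∫ x, |G n x - g x| ∂ν) atTop (𝓝 0) := by
    have := tendsto_integral_of_dominated_convergence (μ := ν)
      (F := fun n x => |G n x - g x|) (f := fun _ => (0 : ℝ))
      (fun _ => 2 * (M * ν.real Set.univ))
      (fun n => (((hGm n).sub hgm).abs).aestronglyMeasurable)
      (integrable_const _)
      (fun n => Eventually.of_forall fun x => by
        rw [Real.norm_eq_abs, abs_abs]
        have := abs_sub (G n x) (g x)
        linarith [hGb n x, hgb x])
      (Eventually.of_forall fun x => by
        have := ((hptw x).sub_const (g x)).abs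
        simpa using this)
    simpa using this
  have h2 : Tendsto (fun n => ∫ x in B n, (G n x - g x) ∂ν) atTop (𝓝 0) := by
    refine squeeze_zero_norm (fun n => ?_) hL1
    refine (norm_integral_le_integral_norm _).trans ?_
    exact setIntegral_le_integral ((hGi n).sub hgi).norm (Eventually.of_forall fun x => norm_nonneg _)
  have h3 := h2.add (hlim g hgm ⟨_, hgb⟩)
  rw [zero_add] at h3
  convert h3 using 1
  funext n
  rw [integral_sub (hGi n).integrableOn hgi.integrableOn]
  ring

open Percolation in
theorem irr_contra (W : ℝ → ℝ → ℝ) (hsymm : ∀ x y, W x y = W y x)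
    (hirr : Percolation.Irreducible W) (f : ℝ → ℝ) (hf : Measurable f)
    (hP0 : volume (I01 ∩ {x | 0 < f x}) ≠ 0) (hQ0 : volume (I01 ∩ {x | f x < 1}) ≠ 0)
    (hz : ∀ᵐ p : ℝ × ℝ, p.1 ∈ I01 → p.2 ∈ I01 → 0 < f p.1 → f p.2 < 1 → W p.1 p.2 = 0) :
    False := by
  have hI : MeasurableSet I01 := measurableSet_Icc
  have hvI : volume I01 = 1 := by simp [I01]
  have hPm : MeasurableSet (I01 ∩ {x | 0 < f x}) := hI.inter (measurableSet_lt measurable_const hf)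
  have hQm : MeasurableSet (I01 ∩ {x | f x < 1}) := hI.inter (measurableSet_lt hf measurable_const)
  have hz' : ∀ᵐ p : ℝ × ℝ, p.1 ∈ I01 → p.2 ∈ I01 → 0 < f p.2 → f p.1 < 1 → W p.1 p.2 = 0 := by
    have := (Measure.measurePreserving_swap (μ := (volume : Measure ℝ))
      (ν := (volume : Measure ℝ))).quasiMeasurePreserving.ae hz
    filter_upwards [this] with p hp h1 h2 h3 h4
    rw [hsymm]
    exact hp h2 h1 h3 h4
  have full : ∀ S : Set ℝ, S ⊆ I01 → MeasurableSet S → ¬ volume S < 1 →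
      ∀ᵐ x : ℝ, x ∈ I01 → x ∈ S := by
    intro S hS hm hlt
    have h1 : volume S = 1 := le_antisymm (hvI ▸ measure_mono hS) (not_lt.1 hlt)
    have h2 : volume (I01 \ S) = 0 := by
      rw [measure_diff hS hm.nullMeasurableSet (by simp [h1]), h1, hvI]; simp
    rw [ae_iff]
    convert h2 using 2
    ext x; simp
  by_cases hP : volume (I01 ∩ {x | 0 < f x}) < 1
  · refine hirr ⟨_, hPm, Set.inter_subset_left, pos_iff_ne_zero.2 hP0, hP, ?_⟩
    filter_upwards [hz] with p hp h1 h2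
    refine hp h1.1 h2.1 h1.2 ?_
    by_contra hcon
    exact h2.2 ⟨h2.1, by simp only [Set.mem_setOf_eq]; linarith⟩
  by_cases hQ : volume (I01 ∩ {x | f x < 1}) < 1
  · refine hirr ⟨_, hQm, Set.inter_subset_left, pos_iff_ne_zero.2 hQ0, hQ, ?_⟩
    filter_upwards [hz'] with p hp h1 h2
    refine hp h1.1 h2.1 ?_ h1.2
    by_contra hcon
    exact h2.2 ⟨h2.1, by simp only [Set.mem_setOf_eq]; linarith⟩
  · have aP := full _ Set.inter_subset_left hPm hP
    have aQ := full _ Set.inter_subset_left hQm hQ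
    have aP' : ∀ᵐ p : ℝ × ℝ, p.1 ∈ I01 → p.1 ∈ I01 ∩ {x | 0 < f x} :=
      Measure.quasiMeasurePreserving_fst.ae aP
    have aQ' : ∀ᵐ p : ℝ × ℝ, p.2 ∈ I01 → p.2 ∈ I01 ∩ {x | f x < 1} :=
      Measure.quasiMeasurePreserving_snd.ae aQ
    refine hirr ⟨Set.Icc 0 (1 / 2), measurableSet_Icc, Set.Icc_subset_Icc le_rfl (by norm_num),
      by simp, ?_, ?_⟩
    · rw [Real.volume_Icc]
      rw [ENNReal.ofReal_lt_one]; norm_num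
    · filter_upwards [hz, aP', aQ'] with p hp h1 h2 h3 h4
      have h3' : p.1 ∈ I01 := Set.Icc_subset_Icc le_rfl (by norm_num) h3
      exact hp h3' h4.1 (h1 h3').2 (h2 h4.1).2

open Percolation MeasureTheory Filter Topology in
/-- If `W` is an irreducible graphon and `0 < a < 1/2`, then there is
`b > 0` such that `W` has no `(a,b)`-cut: there is no measurable `A ⊆ [0,1]` with
`a ≤ μ(A) ≤ 1 - a` and `∫_{A × ([0,1] \ A)} W ≤ b`. -/
theorem no_small_cut
    (W : ℝ → ℝ → ℝ) (hW : IsGraphon W) (hirr : Percolation.Irreducible W)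
    (a : ℝ) (ha0 : 0 < a) (ha : a < 1 / 2) :
    ∃ b : ℝ, 0 < b ∧
      ¬∃ A : Set ℝ, MeasurableSet A ∧ A ⊆ I01 ∧
        ENNReal.ofReal a ≤ volume A ∧ volume A ≤ ENNReal.ofReal (1 - a) ∧
        (∫ x in A, ∫ y in I01 \ A, W x y) ≤ b := by
  by_contra hcon
  push Not at hcon
  obtain ⟨hWm, hW0, hsymm, M, hM⟩ := hW
  have hMabs : ∀ x y, |W x y| ≤ M := fun x y => by rw [abs_of_nonneg (hW0 x y)]; exact hM x y
  choose A hAm hAI hAa hAb hAc using fun n : ℕ => hcon (1 / ((n : ℝ) + 1)) (by positivity)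
  have hI : MeasurableSet I01 := measurableSet_Icc
  have hvI : volume I01 = 1 := by simp [I01]
  set ν : Measure ℝ := volume.restrict I01 with hν
  have hνu : ν Set.univ = 1 := by simp [hν, hvI]
  have : IsProbabilityMeasure ν := ⟨hνu⟩
  obtain ⟨f, φ, hf, hf0, hf1, hφ, hlim⟩ := weak_subseq ν A hAm
  have hcut := cut_limit ν (fun n => A (φ n)) (fun n => hAm _) f hf hf0 hf1 hlim W hWm M hMabs
  have hrA : ∀ n, ν.restrict (A n) = volume.restrict (A n) := fun n => by
    rw [hν, Measure.restrict_restrict (hAm n), Set.inter_eq_left.2 (hAI n)]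
  have hrAc : ∀ n, ν.restrict (A n)ᶜ = volume.restrict (I01 \ A n) := fun n => by
    rw [hν, Measure.restrict_restrict (hAm n).compl, Set.inter_comm]; rfl
  simp only [hrA, hrAc] at hcut
  have hle0 : ∫ x, f x * (∫ y, (1 - f y) * W x y ∂ν) ∂ν ≤ 0 :=
    le_of_tendsto_of_tendsto' hcut
      (tendsto_one_div_add_atTop_nhds_zero_nat.comp hφ.tendsto_atTop) fun n => hAc (φ n)
  let F : ℝ × ℝ → ℝ := fun p => f p.1 * ((1 - f p.2) * W p.1 p.2)
  have hF0 : ∀ p, 0 ≤ F p := fun p =>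
    mul_nonneg (hf0 _) (mul_nonneg (by linarith [hf1 p.2]) (hW0 _ _))
  have hFm : Measurable F := by
    have h1 : Measurable fun p : ℝ × ℝ => f p.1 * ((1 - f p.2) * Function.uncurry W p) := by fun_prop
    exact h1
  have hFi : Integrable F (ν.prod ν) := by
    refine Integrable.of_bound hFm.aestronglyMeasurable M (Eventually.of_forall fun p => ?_)
    rw [Real.norm_eq_abs, abs_of_nonneg (hF0 p)]
    have h1 : (1 - f p.2) * W p.1 p.2 ≤ W p.1 p.2 := by nlinarith [hf0 p.2, hW0 p.1 p.2]
    have h2 : 0 ≤ (1 - f p.2) * W p.1 p.2 := mul_nonneg (by linarith [hf1 p.2]) (hW0 _ _)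
    have h3 := hM p.1 p.2
    have h4 := mul_le_mul_of_nonneg_right (hf1 p.1) h2
    simp only [F]; linarith
  have hF : ∫ p, F p ∂(ν.prod ν) = 0 := by
    refine le_antisymm ?_ (integral_nonneg hF0)
    rw [integral_prod _ hFi]
    simpa only [F, integral_const_mul] using hle0
  have hFae := (integral_eq_zero_iff_of_nonneg hF0 hFi).1 hF
  rw [hν, Measure.prod_restrict, Filter.EventuallyEq, ae_restrict_iff' (hI.prod hI)] at hFae
  have hmass := hlim (fun _ => 1) measurable_const ⟨1, fun x => by simp⟩
  simp only [hrA, mul_one, integral_const, smul_eq_mul, measureReal_restrict_apply_univ] at hmass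
  have hfin : ∀ n, volume (A n) ≠ ⊤ := fun n => ((hAb n).trans_lt ENNReal.ofReal_lt_top).ne
  have hge : a ≤ ∫ x, f x ∂ν := ge_of_tendsto' hmass fun n =>
    (ENNReal.ofReal_le_iff_le_toReal (hfin _)).1 (hAa (φ n))
  have hle : ∫ x, f x ∂ν ≤ 1 - a := le_of_tendsto' hmass fun n =>
    ENNReal.toReal_le_of_le_ofReal (by linarith) (hAb (φ n))
  refine irr_contra W hsymm hirr f hf ?_ ?_ ?_
  · intro h0
    have : f =ᵐ[ν] fun _ => 0 := by
      rw [Filter.EventuallyEq, hν, ae_restrict_iff' hI, ae_iff]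
      refine measure_mono_null ?_ h0
      intro x hx
      simp only [Set.mem_setOf_eq, Classical.not_imp] at hx
      exact ⟨hx.1, lt_of_le_of_ne (hf0 x) (Ne.symm hx.2)⟩
    rw [integral_congr_ae this] at hge
    simp at hge
    linarith
  · intro h0
    have : f =ᵐ[ν] fun _ => 1 := by
      rw [Filter.EventuallyEq, hν, ae_restrict_iff' hI, ae_iff]
      refine measure_mono_null ?_ h0
      intro x hx
      simp only [Set.mem_setOf_eq, Classical.not_imp] at hx
      exact ⟨hx.1, lt_of_le_of_ne (hf1 x) hx.2⟩
    rw [integral_congr_ae this] at hle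
    simp at hle
    linarith
  · filter_upwards [hFae] with p hp h1 h2 h3 h4
    have := hp ⟨h1, h2⟩
    simp only [F, Pi.zero_apply, mul_eq_zero] at this
    rcases this with h | h | h
    · linarith
    · linarith
    · exact h
end
end
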